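/- arXiv:1810.03093 — 6 statements merged into one kernel-verified Lean document; each statement's English description precedes it below -/
import Mathlib

section
/- Let $w\in\mathbb{C}$ and let $a,b$ be positive real numbers with $ab=\pi^2$. Then $e^{-\frac{w^2}{4}}\sum_{n=1}^{\infty}\sum_{r=0}^{\infty}\frac{\sigma_{-1}(n)e^{-2na}}{r!\,(\tfrac12)_r(\tfrac12)_{2r}}\,\Phi_3\!\left(\tfrac12;\tfrac12+2r;\tfrac{w^2}{4},\tfrac{w^2 na}{2}\right)\left(\frac{w^{4}n^{2}a^{2}}{16}\right)^{r} - e^{\frac{w^2}{4}}\sum_{n=1}^{\infty}\sum_{r=0}^{\infty}\frac{\sigma_{-1}(n)e^{-2nb}}{r!\,(\tfrac12)_r(\tfrac12)_{2r}}\,\Phi_3\!\left(\tfrac12;\tfrac12+2r;-\tfrac{w^2}{4},-\tfrac{w^2 nb}{2}\right)\left(\frac{w^{4}n^{2}b^{2}}{16}\right)^{r} = \frac14\Big[\log\frac{a}{b}-\frac{w^2}{2}\Big({}_2F_2\big(1,1;\tfrac32,2;\tfrac{w^2}{4}\big)+{}_2F_2\big(1,1;\tfrac32,2;-\tfrac{w^2}{4}\big)\Big)\Big]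 + \frac{1}{12}\Big[b\Big(1+\frac{w\sqrt{\pi}}{2}e^{\frac{w^2}{4}}\,\mathrm{erf}\big(\tfrac{w}{2}\big)\Big)-a\Big(1-\frac{w\sqrt{\pi}}{2}e^{-\frac{w^2}{4}}\,\mathrm{erfi}\big(\tfrac{w}{2}\big)\Big)\Big]$. -/
open Complex MeasureTheory Filter

noncomputable section

/-- Pochhammer symbol (a)_m = a(a+1)...(a+m-1). -/
def poch (a : ℂ) (m : ℕ) : ℂ := ∏ i ∈ Finset.range m, (a + i)

/-- Confluent hypergeometric function ₁F₁(a;c;z). -/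
def hyp1F1 (a c z : ℂ) : ℂ := ∑' m : ℕ, poch a m / (poch c m * (m.factorial : ℂ)) * z ^ m

/-- Humbert function Φ₃(a;c;x,y). -/
def Phi3 (a c x y : ℂ) : ℂ :=
  ∑' p : ℕ × ℕ,
    poch a p.1 / (poch c (p.1 + p.2) * (p.1.factorial : ℂ) * (p.2.factorial : ℂ))
      * x ^ p.1 * y ^ p.2

/-- Generalized hypergeometric function ₂F₂(a₁,a₂;b₁,b₂;z). -/
def hyp2F2 (a₁ a₂ b₁ b₂ z : ℂ) : ℂ :=
  ∑' m : ℕ, poch a₁ m * poch a₂ m / (poch b₁ m * poch b₂ m * (m.factorial : ℂ)) * z ^ m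

/-- Error function, extended to complex arguments along the segment from 0 to w. -/
def cerf (w : ℂ) : ℂ :=
  2 / (Real.sqrt Real.pi : ℂ) * ∫ t in (0:ℝ)..1, w * Complex.exp (-(((t:ℂ) * w) ^ 2))

/-- Imaginary error function, extended to complex arguments. -/
def cerfi (w : ℂ) : ℂ :=
  2 / (Real.sqrt Real.pi : ℂ) * ∫ t in (0:ℝ)..1, w * Complex.exp (((t:ℂ) * w) ^ 2)

/-- Contour integral along the vertical line Re(s) = c : ∫_{(c)} f(s) ds. -/
def lineInt (c : ℝ) (f : ℂ → ℂ) : ℂ := Complex.I * ∫ t : ℝ, f (c + t * Complex.I)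

/-- Generalized modified Bessel function K_{z,w}(x), defined with contour Re(s)=c. -/
def Kzw (z w x : ℂ) (c : ℝ) : ℂ :=
  (2 * (Real.pi : ℂ) * Complex.I)⁻¹ *
    lineInt c (fun s =>
      Complex.Gamma ((s - z) / 2) * Complex.Gamma ((s + z) / 2) *
        hyp1F1 ((s - z) / 2) (1/2) (-w^2 / 4) * hyp1F1 ((s + z) / 2) (1/2) (-w^2 / 4) *
        (2:ℂ) ^ (s - 2) * x ^ (-s))

/-- Divisor function σ₋₁(n) = ∑_{d ∣ n} 1/d. -/
def sigmaNegOne (n : ℕ) : ℝ := ∑ d ∈ n.divisors, (d : ℝ)⁻¹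

/-- Gaussian density. -/
def gauss (σ x : ℝ) : ℝ := Real.exp (-(x^2) / (2 * σ^2)) / (σ * Real.sqrt (2 * Real.pi))

/-- Lorentzian density. -/
def lorentz (β x : ℝ) : ℝ := β / (Real.pi * (x^2 + β^2))

/-- Voigt profile: convolution of Gaussian and Lorentzian. -/
def voigt (σ β x : ℝ) : ℝ := ∫ t : ℝ, gauss σ t * lorentz β (x - t)

/-- Faddeeva function ξ(y) = e^{-y²}(1 - erf(-iy)). -/
def faddeeva (y : ℂ) : ℂ := Complex.exp (-y^2) * (1 - cerf (-Complex.I * y))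



/-! ### The transformation formula of `log η` on the imaginary axis -/

lemma summable_inv_mul_pow_mul {q : ℝ} (hq0 : 0 ≤ q) (hq1 : q < 1) :
    Summable fun p : ℕ+ × ℕ+ => ((p.1 : ℕ) : ℝ)⁻¹ * q ^ ((p.1 : ℕ) * (p.2 : ℕ)) := by
  have h := summable_prod_mul_pow (𝕜 := ℝ) 0 (r := q) (by rwa [Real.norm_of_nonneg hq0])
  refine Summable.of_nonneg_of_le (fun p => by positivity) (fun p => ?_) h
  have h1 : (1 : ℝ) ≤ ((p.1 : ℕ) : ℝ) := by exact_mod_cast p.1.2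
  simpa using mul_le_of_le_one_left (pow_nonneg hq0 ((p.1 : ℕ) * (p.2 : ℕ))) (inv_le_one_of_one_le₀ h1)

lemma hasSum_log_one_sub_pow_mul {q : ℝ} (hq0 : 0 ≤ q) (hq1 : q < 1) (c : ℕ+) :
    HasSum (fun d : ℕ+ => ((d : ℕ) : ℝ)⁻¹ * q ^ ((d : ℕ) * (c : ℕ)))
      (-Real.log (1 - q ^ (c : ℕ))) := by
  have hc : |q ^ (c : ℕ)| < 1 := by
    rw [abs_of_nonneg (by positivity)]
    exact pow_lt_one₀ hq0 hq1 c.ne_zero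
  have h := Real.hasSum_pow_div_log_of_abs_lt_one hc
  rw [← Equiv.pnatEquivNat.symm.hasSum_iff]
  convert h using 2 with n
  simp only [Function.comp, Equiv.pnatEquivNat_symm_apply, Nat.succPNat_coe]
  rw [mul_comm (n.succ) _, pow_mul]
  push_cast [Nat.succ_eq_add_one]
  ring

lemma hasSum_sigmaNegOne_mul_pow {q : ℝ} (hq0 : 0 ≤ q) (hq1 : q < 1) :
    ∃ S : ℝ, HasSum (fun n : ℕ => sigmaNegOne (n + 1) * q ^ (n + 1)) S ∧
      HasSum (fun n : ℕ => Real.log (1 - q ^ (n + 1))) (-S) := by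
  obtain ⟨S, hS⟩ := summable_inv_mul_pow_mul hq0 hq1
  refine ⟨S, ?_, ?_⟩
  · have h := (sigmaAntidiagonalEquivProd.hasSum_iff).mpr hS
    have h2 := h.sigma (g := fun n : ℕ+ => sigmaNegOne n * q ^ (n : ℕ)) (fun n => by
      have h3 := hasSum_fintype (fun x : Nat.divisorsAntidiagonal (n : ℕ) =>
        ((x.1.1 : ℕ) : ℝ)⁻¹ * q ^ (x.1.1 * x.1.2))
      convert h3 using 1
      · rfl
      rw [Finset.univ_eq_attach]
      rw [Finset.sum_attach (Nat.divisorsAntidiagonal (n : ℕ))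
        (fun x => ((x.1 : ℕ) : ℝ)⁻¹ * q ^ (x.1 * x.2))]
      rw [Nat.sum_divisorsAntidiagonal (fun x y => (x : ℝ)⁻¹ * q ^ (x * y)), sigmaNegOne,
        Finset.sum_mul]
      refine Finset.sum_congr rfl fun i hi => ?_
      rw [Nat.mul_div_cancel' (Nat.dvd_of_mem_divisors hi)])
    have h4 := (Equiv.pnatEquivNat.symm.hasSum_iff).mpr h2
    simpa [Function.comp_def] using h4
  · have h := ((Equiv.prodComm ℕ+ ℕ+).hasSum_iff).mpr hS
    have h2 := h.prod_fiberwise (fun c => hasSum_log_one_sub_pow_mul hq0 hq1 c)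
    have h4 := ((Equiv.pnatEquivNat.symm.hasSum_iff).mpr h2).neg
    simpa [Function.comp_def] using h4

/-- `lambertSum α = ∑ σ₋₁(n) e^{-2nα}`, which is `-log ∏ (1 - e^{-2nα})`. -/
def lambertSum (α : ℝ) : ℝ := ∑' n : ℕ, sigmaNegOne (n + 1) * Real.exp (-2 * ((n : ℝ) + 1) * α)

lemma exp_neg_two_mul (α : ℝ) (n : ℕ) :
    Real.exp (-2 * α) ^ (n + 1) = Real.exp (-2 * ((n : ℝ) + 1) * α) := by
  rw [← Real.exp_nat_mul]
  push_cast
  ring_nf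

lemma exp_neg_two_mul_lt_one {α : ℝ} (hα : 0 < α) : Real.exp (-2 * α) < 1 :=
  Real.exp_lt_one_iff.mpr (by linarith)

lemma hasSum_lambertSum {α : ℝ} (hα : 0 < α) :
    HasSum (fun n : ℕ => sigmaNegOne (n + 1) * Real.exp (-2 * ((n : ℝ) + 1) * α))
      (lambertSum α) := by
  obtain ⟨S, hS, -⟩ := hasSum_sigmaNegOne_mul_pow (Real.exp_nonneg (-2 * α))
    (exp_neg_two_mul_lt_one hα)
  simp only [exp_neg_two_mul] at hS
  exact hS.summable.hasSum

lemma eta_imaginary_axis {α : ℝ} (hα : 0 < α) :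
    ModularForm.eta (((α / Real.pi : ℝ) : ℂ) * Complex.I)
      = ((Real.exp (-α / 12 - lambertSum α) : ℝ) : ℂ) := by
  obtain ⟨S, hS, hlog⟩ := hasSum_sigmaNegOne_mul_pow (Real.exp_nonneg (-2 * α))
    (exp_neg_two_mul_lt_one hα)
  have hL : lambertSum α = S := by
    simp only [exp_neg_two_mul] at hS
    exact hS.tsum_eq
  have hprod := Real.hasProd_of_hasSum_log (fun n => by
    have := pow_lt_one₀ (Real.exp_nonneg (-2 * α)) (exp_neg_two_mul_lt_one hα) (Nat.succ_ne_zero n)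
    simpa using this) hlog
  have hprodC := hprod.map Complex.ofRealHom Complex.continuous_ofReal
  have hpi : (Real.pi : ℂ) ≠ 0 := by exact_mod_cast Real.pi_ne_zero
  have hq : ∀ n : ℕ, 1 - ModularForm.eta_q n (((α / Real.pi : ℝ) : ℂ) * Complex.I)
      = (Complex.ofRealHom ∘ fun n : ℕ => 1 - Real.exp (-2 * α) ^ (n + 1)) n := by
    intro n
    rw [ModularForm.eta_q_eq_pow]
    simp only [Function.comp, Complex.ofRealHom_eq_coe]
    push_cast
    congr 3
    field_simp
    rw [Complex.I_sq]
    ring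
  rw [ModularForm.eta, tprod_congr hq, hprodC.tprod_eq, hL, sub_eq_add_neg, Real.exp_add,
    Function.Periodic.qParam]
  simp only [Complex.ofRealHom_eq_coe, Complex.ofReal_mul]
  congr 1
  rw [Complex.ofReal_exp]
  congr 1
  push_cast
  field_simp
  rw [Complex.I_sq]
  ring

lemma sqrt_pow_twenty_four (z : ℂ) : Complex.sqrt z ^ 24 = z ^ 12 := by
  rw [Complex.sqrt, ← Complex.cpow_nat_mul]
  calc z ^ (((24 : ℕ) : ℂ) * 2⁻¹) = z ^ ((12 : ℕ) : ℂ) := by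
        congr 1
        push_cast
        norm_num
    _ = z ^ 12 := Complex.cpow_natCast z 12

lemma I_pow_twelve : Complex.I ^ 12 = 1 := by
  rw [show 12 = 4 * 3 by norm_num, pow_mul, Complex.I_pow_four, one_pow]

theorem lambertSum_sub_lambertSum {α β : ℝ} (hα : 0 < α) (hβ : 0 < β)
    (h : α * β = Real.pi ^ 2) :
    lambertSum α - lambertSum β = Real.log (α / Real.pi) / 2 + (β - α) / 12 := by
  have hpi := Real.pi_pos
  set z : ℂ := ((α / Real.pi : ℝ) : ℂ) * Complex.I with hz
  have hz0 : z ≠ 0 := by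
    have : α / Real.pi ≠ 0 := by positivity
    simp only [hz]
    exact mul_ne_zero (by exact_mod_cast this) Complex.I_ne_zero
  have hmem : z ∈ UpperHalfPlane.upperHalfPlaneSet := by
    change 0 < z.im
    rw [hz, Complex.im_ofReal_mul]
    simp only [Complex.I_im, mul_one]
    positivity
  have hinv : -1 / z = ((β / Real.pi : ℝ) : ℂ) * Complex.I := by
    rw [div_eq_iff hz0, hz]
    have : (β / Real.pi) * (α / Real.pi) = 1 := by
      field_simp
      linarith
    calc (-1 : ℂ) = (((β / Real.pi) * (α / Real.pi) : ℝ) : ℂ) * (Complex.I * Complex.I) := by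
          rw [this]; simp
      _ = _ := by push_cast; ring
  have hS := ModularForm.eta_comp_eq_csqrt_I_inv hmem
  simp only [Function.comp, Pi.smul_apply, Pi.mul_apply, smul_eq_mul, hinv] at hS
  have h24 := congrArg (· ^ 24) hS
  simp only [mul_pow, inv_pow, sqrt_pow_twenty_four, I_pow_twelve,
    inv_one, one_mul] at h24
  rw [hz, eta_imaginary_axis hα, eta_imaginary_axis hβ, mul_pow] at h24
  rw [I_pow_twelve, mul_one] at h24
  have hR : Real.exp (-β / 12 - lambertSum β) ^ 24
      = (α / Real.pi) ^ 12 * Real.exp (-α / 12 - lambertSum α) ^ 24 := by exact_mod_cast h24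
  have hlog := congrArg Real.log hR
  rw [Real.log_mul (by positivity) (by positivity), Real.log_pow, Real.log_pow, Real.log_pow,
    Real.log_exp, Real.log_exp] at hlog
  push_cast at hlog
  linarith

/-! ### Pochhammer symbols -/

lemma poch_add (a : ℂ) (m n : ℕ) : poch a (m + n) = poch a m * poch (a + m) n := by
  simp only [poch, Finset.prod_range_add]
  congr 1
  refine Finset.prod_congr rfl fun i _ => ?_
  push_cast
  ring

lemma poch_succ (a : ℂ) (m : ℕ) : poch a (m + 1) = poch a m * (a + m) :=
  Finset.prod_range_succ _ _

lemma poch_succ' (a : ℂ) (m : ℕ) : poch a (m + 1) = a * poch (a + 1) m := by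
  rw [add_comm, poch_add]
  simp [poch]

lemma poch_natCast (N M : ℕ) : poch (N : ℂ) M = (N.ascFactorial M : ℂ) := by
  rw [Nat.ascFactorial_eq_prod_range, poch]
  push_cast
  rfl

lemma poch_one (m : ℕ) : poch 1 m = (m.factorial : ℂ) := by
  simpa using poch_natCast 1 m

lemma poch_two (m : ℕ) : poch 2 m = ((m + 1).factorial : ℂ) := by
  rw [← poch_one, poch_succ' 1 m, one_mul]
  norm_num

lemma norm_half_add_natCast (m : ℕ) : ‖(1 / 2 : ℂ) + m‖ = 1 / 2 + m := by
  have : (1 / 2 : ℂ) + m = ((1 / 2 + m : ℝ) : ℂ) := by push_cast; ring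
  rw [this, Complex.norm_of_nonneg (by positivity)]

lemma norm_poch_half_add (m n : ℕ) :
    ‖poch (1 / 2 + (m : ℂ)) n‖ = ∏ i ∈ Finset.range n, (1 / 2 + m + i : ℝ) := by
  rw [poch, norm_prod]
  refine Finset.prod_congr rfl fun i _ => ?_
  have := norm_half_add_natCast (m + i)
  push_cast at this
  rw [add_assoc, this, add_assoc]

lemma poch_half_add_ne_zero (m n : ℕ) : poch (1 / 2 + (m : ℂ)) n ≠ 0 := by
  rw [← norm_pos_iff, norm_poch_half_add]
  exact Finset.prod_pos fun i _ => by positivity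

lemma poch_half_ne_zero (n : ℕ) : poch (1 / 2) n ≠ 0 := by
  simpa using poch_half_add_ne_zero 0 n

lemma norm_poch_half_div_le (m n : ℕ) :
    ‖poch (1 / 2) m / poch (1 / 2) (m + n)‖ ≤ 2 ^ n := by
  rw [poch_add, div_mul_eq_div_div, div_self (poch_half_ne_zero m), norm_div, norm_one,
    norm_poch_half_add, div_le_iff₀ (Finset.prod_pos fun i _ => by positivity)]
  calc (1 : ℝ) = 2 ^ n * ∏ _i ∈ Finset.range n, (1 / 2 : ℝ) := by
        rw [Finset.prod_const, Finset.card_range, ← mul_pow]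
        norm_num
    _ ≤ 2 ^ n * ∏ i ∈ Finset.range n, (1 / 2 + m + i : ℝ) := by
        gcongr with i
        have : (0 : ℝ) ≤ m + i := by positivity
        linarith

lemma norm_ascFactorial_div_poch_half_le (N M : ℕ) :
    ‖(N.ascFactorial M : ℂ) / poch (1 / 2) (N + M)‖ ≤ 2 ^ N := by
  have h0 : (0 : ℝ) < ∏ i ∈ Finset.range M, (1 / 2 + N + i : ℝ) :=
    Finset.prod_pos fun i _ => by positivity
  have h1 : ‖(N.ascFactorial M : ℂ)‖ ≤ ∏ i ∈ Finset.range M, (1 / 2 + N + i : ℝ) := by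
    rw [Complex.norm_natCast, Nat.ascFactorial_eq_prod_range]
    push_cast
    gcongr with i
    linarith
  have h2 := norm_poch_half_div_le 0 N
  rw [zero_add, show poch (1 / 2) 0 = 1 by simp [poch]] at h2
  calc ‖(N.ascFactorial M : ℂ) / poch (1 / 2) (N + M)‖
      = ‖1 / poch (1 / 2) N‖
          * (‖(N.ascFactorial M : ℂ)‖ / ∏ i ∈ Finset.range M, (1 / 2 + N + i : ℝ)) := by
        rw [poch_add, ← norm_poch_half_add, ← norm_div, ← norm_mul]
        congr 1
        have := poch_half_ne_zero N
        have := poch_half_add_ne_zero N M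
        field_simp
    _ ≤ 2 ^ N * 1 := by
        gcongr
        exact (div_le_one h0).mpr h1
    _ = 2 ^ N := mul_one _

lemma norm_inv_poch_half_le (k : ℕ) : ‖(poch (1 / 2) k)⁻¹‖ ≤ 2 ^ k / k.factorial := by
  have h := norm_poch_half_add 0 k
  simp only [Nat.cast_zero, add_zero] at h
  rw [norm_inv, h, inv_eq_one_div, div_le_div_iff₀ (Finset.prod_pos fun i _ => by positivity)
    (by positivity), one_mul, ← Finset.prod_range_add_one_eq_factorial]
  push_cast
  calc ∏ i ∈ Finset.range k, ((i : ℝ) + 1) ≤ ∏ i ∈ Finset.range k, (2 * (1 / 2 + i) : ℝ) := by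
        gcongr with i
        have : (0 : ℝ) ≤ i := by positivity
        linarith
    _ = _ := by rw [Finset.prod_mul_distrib, Finset.prod_const, Finset.card_range]

lemma poch_half_two_mul (r : ℕ) :
    (4 : ℂ) ^ r * ((r.factorial : ℂ) * poch (1 / 2) r) = ((2 * r).factorial : ℂ) := by
  induction r with
  | zero => simp [poch]
  | succ r ih =>
    rw [show 2 * (r + 1) = 2 * r + 1 + 1 by ring, Nat.factorial_succ, Nat.factorial_succ,
      Nat.factorial_succ, poch_succ]
    push_cast
    rw [← ih]
    ring

lemma fwdDiff_poch_div_poch (a c : ℂ) (hc : ∀ i : ℕ, c + i ≠ 0) :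
    fwdDiff (1 : ℕ) (fun m => poch a m / poch c m)
      = ((a - c) / c) • fun m => poch a m / poch (c + 1) m := by
  have hne : ∀ m, poch c m ≠ 0 := fun m => Finset.prod_ne_zero_iff.mpr fun i _ => hc i
  have hne1 : ∀ m, poch (c + 1) m ≠ 0 := fun m => Finset.prod_ne_zero_iff.mpr fun i _ => by
    have := hc (i + 1)
    push_cast at this
    rwa [add_assoc, add_comm 1 (i : ℂ)]
  have hc0 : c ≠ 0 := by simpa using hc 0
  funext m
  have h1 : c * poch (c + 1) m = poch c m * (c + m) := by rw [← poch_succ', poch_succ]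
  have h2 : poch (c + 1) m = poch c m * (c + m) / c := by
    rw [← h1]
    field_simp
  simp only [fwdDiff, Pi.smul_apply, smul_eq_mul]
  rw [poch_succ, poch_succ, h2]
  have := hne m
  have := hc m
  field_simp
  ring

lemma fwdDiff_iter_poch_div_poch (a c : ℂ) (hc : ∀ i : ℕ, c + i ≠ 0) (M : ℕ) :
    (fwdDiff (1 : ℕ))^[M] (fun m => poch a m / poch c m) 0
      = (-1) ^ M * poch (c - a) M / poch c M := by
  induction M generalizing c with
  | zero => simp [poch]
  | succ M ih =>
    have hc1 : ∀ i : ℕ, c + 1 + i ≠ 0 := fun i => by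
      have := hc (i + 1)
      push_cast at this
      rwa [add_assoc, add_comm 1 (i : ℂ)]
    rw [Function.iterate_succ_apply, fwdDiff_poch_div_poch a c hc, fwdDiff_iter_const_smul,
      Pi.smul_apply, ih (c + 1) hc1, poch_succ', poch_succ' c, smul_eq_mul,
      show c + 1 - a = c - a + 1 by ring]
    have hc0 : c ≠ 0 := by simpa using hc 0
    have : poch (c + 1) M ≠ 0 := Finset.prod_ne_zero_iff.mpr fun i _ => hc1 i
    field_simp
    ring

/-- The coefficient form of Kummer's transformation `e^{-z} ₁F₁(a; c; z) = ₁F₁(c - a; c; -z)`. -/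
lemma sum_antidiagonal_kummer (a c : ℂ) (hc : ∀ i : ℕ, c + i ≠ 0) (M : ℕ) :
    ∑ p ∈ Finset.HasAntidiagonal.antidiagonal M,
        (-1 : ℂ) ^ p.2 / (p.2.factorial : ℂ) * (poch a p.1 / (poch c p.1 * (p.1.factorial : ℂ)))
      = (-1) ^ M * poch (c - a) M / (poch c M * (M.factorial : ℂ)) := by
  have h := fwdDiff_iter_eq_sum_shift (1 : ℕ) (fun m => poch a m / poch c m) M 0
  rw [fwdDiff_iter_poch_div_poch a c hc] at h
  rw [Finset.Nat.sum_antidiagonal_eq_sum_range_succ_mk, ← div_div, h, Finset.sum_div]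
  refine Finset.sum_congr rfl fun k hk => ?_
  have hk' : k ≤ M := Nat.lt_succ_iff.mp (Finset.mem_range.mp hk)
  simp only [smul_eq_mul, mul_one, zero_add, zsmul_eq_mul]
  push_cast
  rw [Nat.cast_choose ℂ hk']
  have := Nat.cast_ne_zero (R := ℂ).mpr M.factorial_ne_zero
  have := Nat.cast_ne_zero (R := ℂ).mpr k.factorial_ne_zero
  have := Nat.cast_ne_zero (R := ℂ).mpr (M - k).factorial_ne_zero
  have : poch c k ≠ 0 := Finset.prod_ne_zero_iff.mpr fun i _ => hc i
  field_simp

/-! ### The polynomials generated by `exp (-2 x t / (1 - t))` -/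

lemma HasSum.antidiagonal {E : Type*} [NormedAddCommGroup E] {f : ℕ × ℕ → E} {s : E}
    (h : HasSum f s) : HasSum (fun k => ∑ p ∈ Finset.HasAntidiagonal.antidiagonal k, f p) s := by
  have h' := Finset.HasAntidiagonal.sigmaAntidiagonalEquivProd.hasSum_iff.mpr h
  refine h'.sigma fun k => ?_
  rw [← Finset.sum_coe_sort]
  exact hasSum_fintype _

/-- The polynomials with `∑ lagPoly k x * t ^ k = exp (-2 x t / (1 - t))`
(the Laguerre polynomials of parameter `-1` at `2 x`). -/
def lagPoly (k : ℕ) (x : ℝ) : ℝ :=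
  ∑ p ∈ Finset.HasAntidiagonal.antidiagonal k,
    (p.1.ascFactorial p.2 : ℝ) / ((p.1.factorial : ℝ) * (p.2.factorial : ℝ)) * (-2 * x) ^ p.1

lemma hasSum_ascFactorial_mul_pow (N : ℕ) {t : ℝ} (ht : |t| < 1) :
    HasSum (fun M : ℕ => (N.ascFactorial M : ℝ) / (M.factorial : ℝ) * t ^ M) ((1 - t)⁻¹ ^ N) := by
  cases N with
  | zero =>
    have h := hasSum_single (f := fun M : ℕ =>
      (Nat.ascFactorial 0 M : ℝ) / (M.factorial : ℝ) * t ^ M) 0 fun M hM => by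
        obtain ⟨j, rfl⟩ := Nat.exists_eq_succ_of_ne_zero hM
        simp [Nat.zero_ascFactorial]
    simpa using h
  | succ k =>
    convert! hasSum_choose_mul_geometric_of_norm_lt_one (𝕜 := ℝ) k (r := t)
      (by simpa using ht) using 1
    · funext M
      rw [Nat.ascFactorial_eq_factorial_mul_choose, Nat.cast_mul,
        mul_div_cancel_left₀ _ (Nat.cast_ne_zero.mpr M.factorial_ne_zero), add_comm k M,
        Nat.choose_symm_add]
    · rw [one_div, inv_pow]

lemma hasSum_generating_fiber (y : ℝ) {t : ℝ} (ht : |t| < 1) (N : ℕ) :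
    HasSum (fun M : ℕ => (N.ascFactorial M : ℝ) / ((N.factorial : ℝ) * (M.factorial : ℝ)) *
      y ^ N * t ^ (N + M)) ((y * (t / (1 - t))) ^ N / (N.factorial : ℝ)) := by
  have h := (hasSum_ascFactorial_mul_pow N ht).mul_left ((y * t) ^ N / (N.factorial : ℝ))
  convert! h using 1
  · funext M
    rw [pow_add, mul_pow]
    field_simp
  · rw [div_eq_mul_inv t, ← mul_assoc, mul_pow]
    ring

lemma summable_generating (y : ℝ) {t : ℝ} (ht : |t| < 1) :
    Summable (fun p : ℕ × ℕ => (p.1.ascFactorial p.2 : ℝ) /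
      ((p.1.factorial : ℝ) * (p.2.factorial : ℝ)) * y ^ p.1 * t ^ (p.1 + p.2)) := by
  have ht' : |(|t|)| < 1 := by rwa [abs_abs]
  refine Summable.of_norm ?_
  simp only [norm_mul, norm_div, norm_pow, Real.norm_eq_abs, Nat.abs_cast]
  refine (summable_prod_of_nonneg fun p => ?_).mpr
    ⟨fun N => (hasSum_generating_fiber |y| ht' N).summable, ?_⟩
  · dsimp only [Pi.zero_apply]
    positivity
  · simpa only [(hasSum_generating_fiber |y| ht' _).tsum_eq] using
      Real.summable_pow_div_factorial (|y| * (|t| / (1 - |t|)))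

lemma hasSum_generating (y : ℝ) {t : ℝ} (ht : |t| < 1) :
    HasSum (fun p : ℕ × ℕ => (p.1.ascFactorial p.2 : ℝ) /
      ((p.1.factorial : ℝ) * (p.2.factorial : ℝ)) * y ^ p.1 * t ^ (p.1 + p.2))
      (Real.exp (y * (t / (1 - t)))) := by
  have hexp : HasSum (fun N : ℕ => (y * (t / (1 - t))) ^ N / (N.factorial : ℝ))
      (Real.exp (y * (t / (1 - t)))) := by
    rw [Real.exp_eq_exp_ℝ]
    exact NormedSpace.expSeries_div_hasSum_exp (y * (t / (1 - t)))
  have hs := (summable_generating y ht).hasSum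
  rwa [(hs.prod_fiberwise (hasSum_generating_fiber y ht)).unique hexp] at hs

lemma hasSum_lagPoly_mul_pow (x : ℝ) {t : ℝ} (ht : |t| < 1) :
    HasSum (fun k => lagPoly k x * t ^ k) (Real.exp (-2 * x * (t / (1 - t)))) := by
  convert! (hasSum_generating (-2 * x) ht).antidiagonal using 1
  funext k
  rw [lagPoly, Finset.sum_mul]
  refine Finset.sum_congr rfl fun p hp => ?_
  rw [Finset.HasAntidiagonal.mem_antidiagonal.mp hp]

lemma abs_lagPoly_le (k : ℕ) {x : ℝ} (hx : 0 ≤ x) :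
    |lagPoly k x| ≤ 5 ^ k * Real.exp (x / 2) := by
  have h5 : |(1 / 5 : ℝ)| < 1 := by norm_num [abs_lt]
  have h := (hasSum_generating (2 * x) h5).antidiagonal
  have hle := le_hasSum h k fun j _ => Finset.sum_nonneg fun p _ => by positivity
  rw [show 2 * x * (1 / 5 / (1 - 1 / 5)) = x / 2 by ring] at hle
  calc |lagPoly k x| ≤ ∑ p ∈ Finset.HasAntidiagonal.antidiagonal k, (p.1.ascFactorial p.2 : ℝ) /
          ((p.1.factorial : ℝ) * (p.2.factorial : ℝ)) * (2 * x) ^ p.1 := by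
        refine (Finset.abs_sum_le_sum_abs _ _).trans_eq (Finset.sum_congr rfl fun p _ => ?_)
        rw [abs_mul, abs_pow, neg_mul, abs_neg, abs_of_nonneg (by positivity : 0 ≤ 2 * x),
          abs_of_nonneg (by positivity)]
    _ = 5 ^ k * ∑ p ∈ Finset.HasAntidiagonal.antidiagonal k, (p.1.ascFactorial p.2 : ℝ) /
          ((p.1.factorial : ℝ) * (p.2.factorial : ℝ)) * (2 * x) ^ p.1
            * (1 / 5) ^ (p.1 + p.2) := by
        rw [Finset.mul_sum]
        refine Finset.sum_congr rfl fun p hp => ?_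
        rw [Finset.HasAntidiagonal.mem_antidiagonal.mp hp, one_div, inv_pow]
        field_simp
    _ ≤ 5 ^ k * Real.exp (x / 2) := by gcongr

lemma lagPoly_zero (x : ℝ) : lagPoly 0 x = 1 := by simp [lagPoly]

/-! ### Reduction of the Humbert function -/

lemma summable_norm_pow_div_factorial (z : ℂ) :
    Summable fun n : ℕ => ‖z‖ ^ n / (n.factorial : ℝ) :=
  Real.summable_pow_div_factorial _

lemma hasSum_pow_div_factorial (z : ℂ) :
    HasSum (fun n : ℕ => z ^ n / (n.factorial : ℂ)) (Complex.exp z) := by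
  rw [Complex.exp_eq_exp_ℂ]
  exact NormedSpace.expSeries_div_hasSum_exp z

/-- The bound behind the absolute convergence of `Phi3 (1/2) (1/2)`. -/
lemma norm_Phi3_half_term_le (X Z : ℂ) (m N : ℕ) :
    ‖poch (1 / 2) m / (poch (1 / 2) (m + N) * (m.factorial : ℂ) * (N.factorial : ℂ))
      * X ^ m * Z ^ N‖ ≤ ‖X‖ ^ m / (m.factorial : ℝ) * (‖2 * Z‖ ^ N / (N.factorial : ℝ)) := by
  have h : poch (1 / 2) m / (poch (1 / 2) (m + N) * (m.factorial : ℂ) * (N.factorial : ℂ))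
      * X ^ m * Z ^ N = poch (1 / 2) m / poch (1 / 2) (m + N)
        * (X ^ m / (m.factorial : ℂ) * (Z ^ N / (N.factorial : ℂ))) := by
    have := poch_half_ne_zero (m + N)
    field_simp
  rw [h, norm_mul]
  calc _ ≤ 2 ^ N * ‖X ^ m / (m.factorial : ℂ) * (Z ^ N / (N.factorial : ℂ))‖ := by
        gcongr
        exact norm_poch_half_div_le m N
    _ = _ := by
        simp only [norm_mul, norm_div, norm_pow, Complex.norm_natCast, Complex.norm_ofNat, mul_pow]
        ring

lemma summable_Phi3_half (X Z : ℂ) :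
    Summable fun p : ℕ × ℕ =>
      poch (1 / 2) p.1 / (poch (1 / 2) (p.1 + p.2) * (p.1.factorial : ℂ) * (p.2.factorial : ℂ))
        * X ^ p.1 * Z ^ p.2 :=
  Summable.of_norm_bounded
    ((summable_norm_pow_div_factorial X).mul_of_nonneg (summable_norm_pow_div_factorial (2 * Z))
      (fun _ => by positivity) (fun _ => by positivity))
    fun p => norm_Phi3_half_term_le X Z p.1 p.2

lemma hasSum_Phi3_half (X Z : ℂ) :
    HasSum (fun p : ℕ × ℕ =>
      poch (1 / 2) p.1 / (poch (1 / 2) (p.1 + p.2) * (p.1.factorial : ℂ) * (p.2.factorial : ℂ))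
        * X ^ p.1 * Z ^ p.2) (Phi3 (1 / 2) (1 / 2) X Z) :=
  (summable_Phi3_half X Z).hasSum

lemma Phi3_half_zero_right (X : ℂ) : Phi3 (1 / 2) (1 / 2) X 0 = Complex.exp X := by
  refine ((hasSum_Phi3_half X 0).prod_fiberwise fun m => ?_).unique (hasSum_pow_div_factorial X)
  have h := hasSum_single (f := fun N : ℕ =>
    poch (1 / 2) m / (poch (1 / 2) (m + N) * (m.factorial : ℂ) * (N.factorial : ℂ))
        * X ^ m * (0 : ℂ) ^ N) 0 fun N hN => by simp [hN]
  convert! h using 1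
  have := poch_half_ne_zero m
  simp only [add_zero, Nat.factorial_zero, Nat.cast_one, mul_one, pow_zero]
  field_simp

lemma sum_antidiagonal_Phi3_half_mul_exp (X Z : ℂ) (N M : ℕ) :
    ∑ p ∈ Finset.HasAntidiagonal.antidiagonal M,
      (poch (1 / 2) p.1 / (poch (1 / 2) (p.1 + N) * (p.1.factorial : ℂ) * (N.factorial : ℂ))
        * X ^ p.1 * Z ^ N) * ((-X) ^ p.2 / (p.2.factorial : ℂ))
      = (N.ascFactorial M : ℂ) / poch (1 / 2) (N + M) * ((-X) ^ M / (M.factorial : ℂ)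
        * (Z ^ N / (N.factorial : ℂ))) := by
  have hc : ∀ i : ℕ, (1 / 2 + (N : ℂ)) + i ≠ 0 := fun i => by
    have := norm_half_add_natCast (N + i)
    push_cast at this
    rw [← norm_pos_iff, add_assoc, this]
    positivity
  have h := sum_antidiagonal_kummer (1 / 2) (1 / 2 + (N : ℂ)) hc M
  rw [add_sub_cancel_left, poch_natCast] at h
  have h1 := poch_half_ne_zero N
  have h2 := poch_half_add_ne_zero N M
  calc _ = X ^ M * Z ^ N / ((N.factorial : ℂ) * poch (1 / 2) N)
        * ∑ p ∈ Finset.HasAntidiagonal.antidiagonal M, (-1 : ℂ) ^ p.2 / (p.2.factorial : ℂ)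
          * (poch (1 / 2) p.1 / (poch (1 / 2 + (N : ℂ)) p.1 * (p.1.factorial : ℂ))) := by
        rw [Finset.mul_sum]
        refine Finset.sum_congr rfl fun p hp => ?_
        have h3 := poch_half_add_ne_zero N p.1
        rw [← Finset.HasAntidiagonal.mem_antidiagonal.mp hp, pow_add, neg_pow X, add_comm p.1 N,
          poch_add]
        field_simp
    _ = _ := by
        rw [h, poch_add, neg_pow X]
        field_simp

lemma hasSum_cauchyProduct (f g c : ℕ → ℂ) {t : ℂ} (hf : Summable fun n => ‖f n‖)
    (hg : Summable fun n => ‖g n‖) (ht : HasSum g t)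
    (hc : ∀ k, ∑ p ∈ Finset.HasAntidiagonal.antidiagonal k, f p.1 * g p.2 = c k) :
    HasSum c ((∑' n, f n) * t) := by
  rw [← ht.tsum_eq, tsum_mul_tsum_eq_tsum_sum_antidiagonal_of_summable_norm hf hg]
  simpa only [hc] using (summable_norm_sum_mul_antidiagonal_of_summable_norm hf hg).of_norm.hasSum

lemma summable_norm_Phi3_half_fiber (X Z : ℂ) (N : ℕ) :
    Summable fun m : ℕ => ‖poch (1 / 2) m / (poch (1 / 2) (m + N) * (m.factorial : ℂ)
      * (N.factorial : ℂ)) * X ^ m * Z ^ N‖ :=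
  Summable.of_nonneg_of_le (fun _ => norm_nonneg _) (fun m => norm_Phi3_half_term_le X Z m N)
    ((summable_norm_pow_div_factorial X).mul_right _)

lemma hasSum_Phi3_half_fiber_mul_exp (X Z : ℂ) (N : ℕ) :
    HasSum (fun M : ℕ => (N.ascFactorial M : ℂ) / poch (1 / 2) (N + M)
      * ((-X) ^ M / (M.factorial : ℂ) * (Z ^ N / (N.factorial : ℂ))))
      ((∑' m : ℕ, poch (1 / 2) m / (poch (1 / 2) (m + N) * (m.factorial : ℂ) * (N.factorial : ℂ))
        * X ^ m * Z ^ N) * Complex.exp (-X)) := by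
  have he : Summable fun i : ℕ => ‖(-X) ^ i / (i.factorial : ℂ)‖ := by
    simpa using summable_norm_pow_div_factorial (-X)
  exact hasSum_cauchyProduct (fun m : ℕ => poch (1 / 2) m / (poch (1 / 2) (m + N)
      * (m.factorial : ℂ) * (N.factorial : ℂ)) * X ^ m * Z ^ N)
    (fun i : ℕ => (-X) ^ i / (i.factorial : ℂ)) _ (summable_norm_Phi3_half_fiber X Z N) he
    (hasSum_pow_div_factorial (-X)) (sum_antidiagonal_Phi3_half_mul_exp X Z N)

lemma summable_ascFactorial_div_poch_half (X Z : ℂ) :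
    Summable fun p : ℕ × ℕ => (p.1.ascFactorial p.2 : ℂ) / poch (1 / 2) (p.1 + p.2)
      * ((-X) ^ p.2 / (p.2.factorial : ℂ) * (Z ^ p.1 / (p.1.factorial : ℂ))) := by
  refine Summable.of_norm_bounded ((summable_norm_pow_div_factorial (2 * Z)).mul_of_nonneg
    (summable_norm_pow_div_factorial X) (fun _ => by positivity) (fun _ => by positivity))
    fun p => ?_
  rw [norm_mul]
  calc _ ≤ 2 ^ p.1 * ‖(-X) ^ p.2 / (p.2.factorial : ℂ) * (Z ^ p.1 / (p.1.factorial : ℂ))‖ := by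
        gcongr
        exact norm_ascFactorial_div_poch_half_le p.1 p.2
    _ = _ := by
        simp only [norm_mul, norm_div, norm_pow, norm_neg, Complex.norm_natCast,
          Complex.norm_ofNat, mul_pow]
        ring

lemma hasSum_Phi3_half_swap (X Z : ℂ) :
    HasSum (fun N : ℕ => ∑' m : ℕ, poch (1 / 2) m / (poch (1 / 2) (m + N)
      * (m.factorial : ℂ) * (N.factorial : ℂ)) * X ^ m * Z ^ N) (Phi3 (1 / 2) (1 / 2) X Z) := by
  have hswap : HasSum (fun p : ℕ × ℕ => poch (1 / 2) p.2 / (poch (1 / 2) (p.2 + p.1)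
      * (p.2.factorial : ℂ) * (p.1.factorial : ℂ)) * X ^ p.2 * Z ^ p.1)
      (Phi3 (1 / 2) (1 / 2) X Z) := by
    have h := (Equiv.prodComm ℕ ℕ).hasSum_iff.mpr (hasSum_Phi3_half X Z)
    simpa only [Function.comp_def, Equiv.prodComm_apply, Prod.fst_swap, Prod.snd_swap] using h
  exact hswap.prod_fiberwise fun N => (hswap.summable.prod_factor N).hasSum

lemma hasSum_exp_neg_mul_Phi3_half (X : ℂ) (x : ℝ) :
    HasSum (fun k : ℕ => (-X) ^ k / poch (1 / 2) k * (lagPoly k x : ℂ))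
      (Complex.exp (-X) * Phi3 (1 / 2) (1 / 2) X (2 * X * x)) := by
  have htot := (summable_ascFactorial_div_poch_half X (2 * X * x)).hasSum
  rw [(htot.prod_fiberwise (hasSum_Phi3_half_fiber_mul_exp X (2 * X * x))).unique
    ((hasSum_Phi3_half_swap X (2 * X * x)).mul_right _)] at htot
  rw [mul_comm]
  convert! htot.antidiagonal using 1
  funext k
  rw [lagPoly]
  push_cast
  rw [Finset.mul_sum]
  refine Finset.sum_congr rfl fun p hp => ?_
  rw [← Finset.HasAntidiagonal.mem_antidiagonal.mp hp,
    show 2 * X * (x : ℂ) = -X * (-2 * x) by ring, mul_pow (-X), pow_add]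
  have := poch_half_ne_zero (p.1 + p.2)
  field_simp

/-- The expansion of `Phi3 (1/2) (1/2) X (Y + Z)` in powers of `Z`. -/
lemma hasSum_Phi3_half_add (X Y Z : ℂ) :
    HasSum (fun q : ℕ × ℕ × ℕ => poch (1 / 2) q.2.1 / (poch (1 / 2) (q.2.1 + (q.2.2 + q.1))
        * (q.2.1.factorial : ℂ) * (q.2.2.factorial : ℂ) * (q.1.factorial : ℂ))
        * X ^ q.2.1 * Y ^ q.2.2 * Z ^ q.1) (Phi3 (1 / 2) (1 / 2) X (Y + Z)) := by
  have hsum : Summable (fun q : ℕ × ℕ × ℕ => poch (1 / 2) q.1 / (poch (1 / 2)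
        (q.1 + (q.2.1 + q.2.2)) * (q.1.factorial : ℂ) * (q.2.1.factorial : ℂ)
        * (q.2.2.factorial : ℂ)) * X ^ q.1 * Y ^ q.2.1 * Z ^ q.2.2) := by
    refine Summable.of_norm_bounded ((summable_norm_pow_div_factorial X).mul_of_nonneg
      ((summable_norm_pow_div_factorial (2 * Y)).mul_of_nonneg
        (summable_norm_pow_div_factorial (2 * Z)) (fun _ => by positivity)
        (fun _ => by positivity)) (fun _ => by positivity)
      (fun _ => mul_nonneg (by positivity) (by positivity))) ?_
    rintro ⟨m, n, j⟩
    have h : poch (1 / 2) m / (poch (1 / 2) (m + (n + j)) * (m.factorial : ℂ) * (n.factorial : ℂ)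
        * (j.factorial : ℂ)) * X ^ m * Y ^ n * Z ^ j
        = poch (1 / 2) m / poch (1 / 2) (m + (n + j)) * (X ^ m / (m.factorial : ℂ)
          * (Y ^ n / (n.factorial : ℂ) * (Z ^ j / (j.factorial : ℂ)))) := by
      have := poch_half_ne_zero (m + (n + j))
      field_simp
    dsimp only
    rw [h, norm_mul]
    calc _ ≤ 2 ^ (n + j) * ‖X ^ m / (m.factorial : ℂ)
            * (Y ^ n / (n.factorial : ℂ) * (Z ^ j / (j.factorial : ℂ)))‖ := by
          gcongr
          exact norm_poch_half_div_le m (n + j)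
      _ = _ := by
          simp only [norm_mul, norm_div, norm_pow, Complex.norm_natCast, Complex.norm_ofNat,
            mul_pow, pow_add]
          ring
  have hfib : ∀ m : ℕ, HasSum (fun p : ℕ × ℕ => poch (1 / 2) m / (poch (1 / 2)
        (m + (p.1 + p.2)) * (m.factorial : ℂ) * (p.1.factorial : ℂ)
        * (p.2.factorial : ℂ)) * X ^ m * Y ^ p.1 * Z ^ p.2)
      (∑' N : ℕ, poch (1 / 2) m / (poch (1 / 2) (m + N) * (m.factorial : ℂ) * (N.factorial : ℂ))
        * X ^ m * (Y + Z) ^ N) := fun m => by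
    have h := (hsum.prod_factor m).hasSum
    have h2 := h.antidiagonal
    have h3 : ∀ N : ℕ, ∑ p ∈ Finset.HasAntidiagonal.antidiagonal N, poch (1 / 2) m / (poch (1 / 2)
        (m + (p.1 + p.2)) * (m.factorial : ℂ) * (p.1.factorial : ℂ)
        * (p.2.factorial : ℂ)) * X ^ m * Y ^ p.1 * Z ^ p.2
        = poch (1 / 2) m / (poch (1 / 2) (m + N) * (m.factorial : ℂ) * (N.factorial : ℂ))
          * X ^ m * (Y + Z) ^ N := fun N => by
      rw [(Commute.all Y Z).add_pow', Finset.mul_sum]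
      refine Finset.sum_congr rfl fun p hp => ?_
      have hN := Finset.HasAntidiagonal.mem_antidiagonal.mp hp
      rw [hN, nsmul_eq_mul, ← hN, Nat.cast_add_choose]
      have := poch_half_ne_zero (m + (p.1 + p.2))
      have := Nat.cast_ne_zero (R := ℂ).mpr (p.1 + p.2).factorial_ne_zero
      field_simp
    simp only [h3] at h2
    rw [← h2.tsum_eq] at h
    exact h
  have htot := hsum.hasSum
  have hPhi := (hasSum_Phi3_half X (Y + Z)).prod_fiberwise
    fun m => ((summable_Phi3_half X (Y + Z)).prod_factor m).hasSum
  rw [(htot.prod_fiberwise hfib).unique hPhi] at htot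
  let e : ℕ × ℕ × ℕ ≃ ℕ × ℕ × ℕ :=
    { toFun := fun q => (q.2.1, q.2.2, q.1)
      invFun := fun q => (q.2.2, q.1, q.2.1)
      left_inv := fun _ => rfl
      right_inv := fun _ => rfl }
  exact (e.hasSum_iff).mpr htot

lemma hasSum_Phi3_half_even (X Y : ℂ) :
    HasSum (fun r : ℕ => 1 / ((r.factorial : ℂ) * poch (1 / 2) r * poch (1 / 2) (2 * r))
        * Phi3 (1 / 2) (1 / 2 + 2 * (r : ℂ)) X Y * (Y ^ 2 / 4) ^ r)
      ((Complex.exp X + Phi3 (1 / 2) (1 / 2) X (2 * Y)) / 2) := by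
  have h1 := hasSum_Phi3_half_add X Y Y
  have h2 := hasSum_Phi3_half_add X Y (-Y)
  rw [← two_mul] at h1
  rw [add_neg_cancel, Phi3_half_zero_right] at h2
  have hfib : ∀ (Z : ℂ) (j : ℕ), ∑' p : ℕ × ℕ, poch (1 / 2) p.1 / (poch (1 / 2)
      (p.1 + (p.2 + j)) * (p.1.factorial : ℂ) * (p.2.factorial : ℂ) * (j.factorial : ℂ))
      * X ^ p.1 * Y ^ p.2 * Z ^ j
      = Z ^ j / ((j.factorial : ℂ) * poch (1 / 2) j) * Phi3 (1 / 2) (1 / 2 + (j : ℂ)) X Y := by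
    intro Z j
    rw [Phi3, ← tsum_mul_left]
    refine tsum_congr fun p => ?_
    rw [show p.1 + (p.2 + j) = j + (p.1 + p.2) by ring, poch_add]
    have := poch_half_ne_zero j
    have := poch_half_add_ne_zero j (p.1 + p.2)
    field_simp
  have h3 := (h2.prod_fiberwise fun j => (h2.summable.prod_factor j).hasSum).add
    (h1.prod_fiberwise fun j => (h1.summable.prod_factor j).hasSum)
  simp only [hfib] at h3
  have h4 := h3.div_const 2
  rw [← (mul_right_injective₀ (two_ne_zero' ℕ)).hasSum_iff] at h4
  · convert! h4 using 1
    funext r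
    have := poch_half_ne_zero (2 * r)
    have := poch_half_ne_zero r
    simp only [Function.comp, (even_two_mul r).neg_pow]
    rw [← poch_half_two_mul r, div_pow, pow_mul]
    push_cast
    field_simp
    ring
  · intro j hj
    have hodd : Odd j := by
      rw [← Nat.not_even_iff_odd]
      rintro ⟨r, rfl⟩
      exact hj ⟨r, by ring⟩
    rw [hodd.neg_pow]
    ring

/-! ### Lambert series weighted by `lagPoly` -/

/-- The coefficients in `t` of `lambertSum (α * (1 + t) / (1 - t))`. -/
def lagSum (k : ℕ) (α : ℝ) : ℝ :=
  ∑' n : ℕ, sigmaNegOne (n + 1) * Real.exp (-2 * ((n : ℝ) + 1) * α)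
    * lagPoly k (2 * ((n : ℝ) + 1) * α)

lemma sigmaNegOne_nonneg (n : ℕ) : 0 ≤ sigmaNegOne n :=
  Finset.sum_nonneg fun _ _ => by positivity

lemma abs_lagSum_term_le (k n : ℕ) {α : ℝ} (hα : 0 < α) :
    |sigmaNegOne (n + 1) * Real.exp (-2 * ((n : ℝ) + 1) * α) * lagPoly k (2 * ((n : ℝ) + 1) * α)|
      ≤ sigmaNegOne (n + 1) * Real.exp (-2 * ((n : ℝ) + 1) * (α / 2)) * 5 ^ k := by
  have h := abs_lagPoly_le k (x := 2 * ((n : ℝ) + 1) * α) (by positivity)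
  have h0 := sigmaNegOne_nonneg (n + 1)
  rw [abs_mul, abs_of_nonneg (mul_nonneg h0 (Real.exp_pos _).le)]
  calc _ ≤ sigmaNegOne (n + 1) * Real.exp (-2 * ((n : ℝ) + 1) * α)
        * (5 ^ k * Real.exp (2 * ((n : ℝ) + 1) * α / 2)) :=
        mul_le_mul_of_nonneg_left h (mul_nonneg h0 (Real.exp_pos _).le)
    _ = sigmaNegOne (n + 1) * (Real.exp (-2 * ((n : ℝ) + 1) * α)
        * Real.exp (2 * ((n : ℝ) + 1) * α / 2)) * 5 ^ k := by ring
    _ = _ := by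
        rw [← Real.exp_add]
        congr 3
        ring

lemma summable_lagSum (k : ℕ) {α : ℝ} (hα : 0 < α) :
    Summable fun n : ℕ => sigmaNegOne (n + 1) * Real.exp (-2 * ((n : ℝ) + 1) * α)
      * lagPoly k (2 * ((n : ℝ) + 1) * α) :=
  Summable.of_norm_bounded ((hasSum_lambertSum (half_pos hα)).summable.mul_right (5 ^ k))
    fun n => abs_lagSum_term_le k n hα

lemma lagSum_zero (α : ℝ) : lagSum 0 α = lambertSum α := by
  simp only [lagSum, lambertSum, lagPoly_zero, mul_one]

lemma exists_hasSum_lagSum {α : ℝ} (hα : 0 < α) {c F : ℕ → ℂ}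
    (hc : Summable fun k => ‖c k‖ * 5 ^ k)
    (hF : ∀ n : ℕ, HasSum (fun k => c k * (lagPoly k (2 * ((n : ℝ) + 1) * α) : ℂ)) (F n)) :
    ∃ S : ℂ, HasSum (fun n : ℕ =>
        ((sigmaNegOne (n + 1) * Real.exp (-2 * ((n : ℝ) + 1) * α) : ℝ) : ℂ) * F n) S ∧
      HasSum (fun k => c k * (lagSum k α : ℂ)) S := by
  have hsum : Summable fun p : ℕ × ℕ =>
      ((sigmaNegOne (p.1 + 1) * Real.exp (-2 * ((p.1 : ℝ) + 1) * α) : ℝ) : ℂ)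
        * (c p.2 * (lagPoly p.2 (2 * ((p.1 : ℝ) + 1) * α) : ℂ)) := by
    refine Summable.of_norm_bounded ((hasSum_lambertSum (half_pos hα)).summable.mul_of_nonneg hc
      (fun n => mul_nonneg (sigmaNegOne_nonneg _) (Real.exp_pos _).le)
      (fun k => by positivity)) fun p => ?_
    have h := mul_le_mul_of_nonneg_left (abs_lagSum_term_le p.2 p.1 hα) (norm_nonneg (c p.2))
    rw [norm_mul, norm_mul, Complex.norm_real, Complex.norm_real, Real.norm_eq_abs,
      Real.norm_eq_abs]
    rw [abs_mul] at h
    linarith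
  obtain ⟨S, hS⟩ := hsum
  refine ⟨S, hS.prod_fiberwise fun n => (hF n).mul_left _, ?_⟩
  have hswap : HasSum (fun p : ℕ × ℕ =>
      ((sigmaNegOne (p.2 + 1) * Real.exp (-2 * ((p.2 : ℝ) + 1) * α) : ℝ) : ℂ)
        * (c p.1 * (lagPoly p.1 (2 * ((p.2 : ℝ) + 1) * α) : ℂ))) S := by
    have h := (Equiv.prodComm ℕ ℕ).hasSum_iff.mpr hS
    simpa only [Function.comp_def, Equiv.prodComm_apply, Prod.fst_swap, Prod.snd_swap] using h
  refine hswap.prod_fiberwise fun k => ?_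
  have h := (Complex.hasSum_ofReal.mpr (summable_lagSum k hα).hasSum).mul_left (c k)
  convert! h using 1
  funext n
  push_cast
  ring

lemma hasSum_lagSum_mul_pow {α : ℝ} (hα : 0 < α) {t : ℝ} (ht : |t| < 1 / 5) :
    HasSum (fun k => lagSum k α * t ^ k) (lambertSum (α * ((1 + t) / (1 - t)))) := by
  have ht1 : |t| < 1 := ht.trans (by norm_num)
  obtain ⟨hl, hu⟩ := abs_lt.mp ht1
  have hpos : 0 < α * ((1 + t) / (1 - t)) :=
    mul_pos hα (div_pos (by linarith) (by linarith))
  have hc : Summable fun k => ‖(t : ℂ) ^ k‖ * 5 ^ k := by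
    simp only [norm_pow, Complex.norm_real, Real.norm_eq_abs, ← mul_pow]
    exact summable_geometric_of_lt_one (by positivity) (by linarith)
  obtain ⟨S, h1, h2⟩ := exists_hasSum_lagSum hα hc
    (F := fun n => (Real.exp (-2 * (2 * ((n : ℝ) + 1) * α) * (t / (1 - t))) : ℂ)) fun n => by
      have h := Complex.hasSum_ofReal.mpr (hasSum_lagPoly_mul_pow (2 * ((n : ℝ) + 1) * α) ht1)
      convert! h using 1
      funext k
      push_cast
      ring
  have h3 := Complex.hasSum_ofReal.mpr (hasSum_lambertSum hpos)
  have hS : S = (lambertSum (α * ((1 + t) / (1 - t))) : ℂ) := by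
    refine h1.unique ?_
    convert! h3 using 1
    funext n
    rw [← Complex.ofReal_mul, mul_assoc, ← Real.exp_add]
    congr 3
    have : 1 - t ≠ 0 := by linarith
    field_simp
    ring
  rw [hS] at h2
  rw [← Complex.hasSum_ofReal]
  convert! h2 using 1
  funext k
  push_cast
  ring

/-! ### The transformation of the weighted Lambert series -/

lemma coeff_eq_of_hasSum_pow {c d : ℕ → ℝ} {f : ℝ → ℝ} {r : ℝ} (hr : 0 < r)
    (hc : ∀ t, |t| < r → HasSum (fun k => c k * t ^ k) (f t))
    (hd : ∀ t, |t| < r → HasSum (fun k => d k * t ^ k) (f t)) : c = d := by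
  have key : ∀ e : ℕ → ℝ, (∀ t, |t| < r → HasSum (fun k => e k * t ^ k) (f t)) →
      HasFPowerSeriesAt f (FormalMultilinearSeries.ofScalars ℝ e) 0 := fun e he => by
    rw [hasFPowerSeriesAt_iff]
    filter_upwards [Metric.ball_mem_nhds (0 : ℝ) hr] with t ht
    rw [mem_ball_zero_iff, Real.norm_eq_abs] at ht
    simpa [FormalMultilinearSeries.coeff_ofScalars, mul_comm] using he t ht
  have h := (key c hc).eq_formalMultilinearSeries (key d hd)
  funext k
  rw [← FormalMultilinearSeries.coeff_ofScalars (𝕜 := ℝ) (p := c), h,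
    FormalMultilinearSeries.coeff_ofScalars]

lemma hasSum_pow_div_log {t : ℝ} (ht : |t| < 1) :
    HasSum (fun k : ℕ => t ^ k / (k : ℝ)) (-Real.log (1 - t)) := by
  rw [← hasSum_nat_add_iff' 1]
  simpa using Real.hasSum_pow_div_log_of_abs_lt_one ht

lemma lagSum_sub_lagSum {a b : ℝ} (ha : 0 < a) (hb : 0 < b) (hab : a * b = Real.pi ^ 2) (k : ℕ) :
    lagSum k a - (-1) ^ k * lagSum k b = (1 - (-1) ^ k) / (2 * (k : ℝ))
      + (b * (-1) ^ k - a) / 6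
      + if k = 0 then Real.log (a / Real.pi) / 2 - (b - a) / 12 else 0 := by
  refine congrFun (coeff_eq_of_hasSum_pow
    (c := fun k => lagSum k a - (-1) ^ k * lagSum k b)
    (d := fun k => (1 - (-1) ^ k) / (2 * (k : ℝ)) + (b * (-1) ^ k - a) / 6
      + if k = 0 then Real.log (a / Real.pi) / 2 - (b - a) / 12 else 0)
    (f := fun t => lambertSum (a * ((1 + t) / (1 - t))) - lambertSum (b * ((1 + -t) / (1 - -t))))
    (r := 1 / 5) (by norm_num) (fun t ht => ?_) fun t ht => ?_) k
  · have h := (hasSum_lagSum_mul_pow ha ht).sub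
      (hasSum_lagSum_mul_pow hb (t := -t) (by rwa [abs_neg]))
    convert! h using 1
    funext k
    rw [neg_pow t]
    ring
  · have ht1 : |t| < 1 := ht.trans (by norm_num)
    have ht2 : |-t| < 1 := by rwa [abs_neg]
    obtain ⟨hl, hu⟩ := abs_lt.mp ht1
    have hp : 0 < 1 + t := by linarith
    have hm : 0 < 1 - t := by linarith
    have h1 := ((hasSum_pow_div_log ht1).sub (hasSum_pow_div_log ht2)).div_const 2
    have h2 := (((hasSum_geometric_of_abs_lt_one ht2).mul_left b).sub
      ((hasSum_geometric_of_abs_lt_one ht1).mul_left a)).div_const 6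
    have h3 := hasSum_ite_eq (0 : ℕ) (Real.log (a / Real.pi) / 2 - (b - a) / 12)
    have h := (h1.add h2).add h3
    have hval : lambertSum (a * ((1 + t) / (1 - t))) - lambertSum (b * ((1 + -t) / (1 - -t)))
        = (-Real.log (1 - t) - -Real.log (1 - -t)) / 2
          + (b * (1 - -t)⁻¹ - a * (1 - t)⁻¹) / 6
          + (Real.log (a / Real.pi) / 2 - (b - a) / 12) := by
      rw [sub_neg_eq_add, ← sub_eq_add_neg, lambertSum_sub_lambertSum
        (mul_pos ha (div_pos hp hm)) (mul_pos hb (div_pos hm hp)) (by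
          rw [← hab]
          field_simp),
        mul_div_right_comm, Real.log_mul (by positivity) (div_pos hp hm).ne',
        Real.log_div hp.ne' hm.ne']
      field_simp
      ring
    rw [hval]
    convert! h using 1
    funext k
    rw [neg_pow t]
    split_ifs with hk
    · simp [hk]
    · field_simp
      ring

/-! ### Closed forms of the resulting power series -/

lemma poch_half_succ (k : ℕ) : poch (1 / 2) (k + 1) = 1 / 2 * poch (3 / 2) k := by
  rw [poch_succ']
  norm_num

lemma poch_three_halves_ne_zero (k : ℕ) : poch (3 / 2) k ≠ 0 := fun h =>
  poch_half_ne_zero (k + 1) (by rw [poch_half_succ, h, mul_zero])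

lemma norm_pow_div_poch_half_le (X : ℂ) (k : ℕ) :
    ‖X ^ k / poch (1 / 2) k‖ ≤ (2 * ‖X‖) ^ k / (k.factorial : ℝ) := by
  rw [div_eq_mul_inv, norm_mul, norm_pow, mul_pow, mul_comm (2 ^ k), mul_div_assoc]
  gcongr
  exact norm_inv_poch_half_le k

lemma hasSum_pow_div_mul_poch_half (X : ℂ) :
    HasSum (fun k : ℕ => X ^ k / ((k : ℂ) * poch (1 / 2) k)) (2 * X * hyp2F2 1 1 (3 / 2) 2 X) := by
  have hsum : Summable fun k : ℕ => X ^ k / ((k : ℂ) * poch (1 / 2) k) := by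
    refine Summable.of_norm_bounded (Real.summable_pow_div_factorial (2 * ‖X‖)) fun k => ?_
    refine le_trans ?_ (norm_pow_div_poch_half_le X k)
    rcases k with _ | k
    · simp
    · rw [mul_comm, ← div_div, norm_div]
      refine div_le_self (norm_nonneg _) ?_
      rw [Complex.norm_natCast]
      exact_mod_cast k.succ_pos
  have h := (hasSum_nat_add_iff' 1).mpr hsum.hasSum
  rw [Finset.sum_range_one, Nat.cast_zero, zero_mul, div_zero, sub_zero] at h
  have heq : ∑' k : ℕ, X ^ k / ((k : ℂ) * poch (1 / 2) k) = 2 * X * hyp2F2 1 1 (3 / 2) 2 X := by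
    rw [← h.tsum_eq, hyp2F2, ← tsum_mul_left]
    refine tsum_congr fun m => ?_
    have h1 := poch_three_halves_ne_zero m
    have h2 : (m : ℂ) + 1 ≠ 0 := Nat.cast_add_one_ne_zero m
    have h3 : (m.factorial : ℂ) ≠ 0 := Nat.cast_ne_zero.mpr m.factorial_ne_zero
    rw [poch_half_succ, poch_one, poch_two, Nat.factorial_succ]
    push_cast
    field_simp
    ring
  rw [← heq]
  exact hsum.hasSum

lemma integral_one_sub_sq_pow_succ (k : ℕ) :
    (2 * (k : ℝ) + 3) * ∫ t in (0 : ℝ)..1, (1 - t ^ 2) ^ (k + 1)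
      = 2 * ((k : ℝ) + 1) * ∫ t in (0 : ℝ)..1, (1 - t ^ 2) ^ k := by
  have hd : ∀ t ∈ Set.uIcc (0 : ℝ) 1, HasDerivAt (fun t : ℝ => t * (1 - t ^ 2) ^ (k + 1))
      ((2 * (k : ℝ) + 3) * (1 - t ^ 2) ^ (k + 1) - 2 * ((k : ℝ) + 1) * (1 - t ^ 2) ^ k) t := by
    intro t _
    have h := (hasDerivAt_id t).mul ((((hasDerivAt_id t).pow 2).const_sub 1).pow (k + 1))
    convert! h using 1
    simp only [id, Nat.add_sub_cancel, Pi.pow_apply]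
    push_cast
    ring
  have h := intervalIntegral.integral_eq_sub_of_hasDerivAt hd
    (Continuous.intervalIntegrable (by fun_prop) _ _)
  rw [intervalIntegral.integral_sub (Continuous.intervalIntegrable (by fun_prop) _ _)
    (Continuous.intervalIntegrable (by fun_prop) _ _), intervalIntegral.integral_const_mul,
    intervalIntegral.integral_const_mul] at h
  simp only [one_pow, sub_self, zero_mul, mul_zero, ne_eq, Nat.succ_ne_zero, not_false_eq_true,
    zero_pow] at h
  linarith

lemma integral_one_sub_sq_pow (k : ℕ) :
    ((∫ t in (0 : ℝ)..1, (1 - t ^ 2) ^ k : ℝ) : ℂ) = (k.factorial : ℂ) / poch (3 / 2) k := by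
  rw [eq_div_iff (poch_three_halves_ne_zero k)]
  induction k with
  | zero => simp [poch]
  | succ k ih =>
    have h := congrArg (fun r : ℝ => (r : ℂ)) (integral_one_sub_sq_pow_succ k)
    push_cast at h ih ⊢
    rw [poch_succ, Nat.factorial_succ]
    push_cast
    linear_combination (1 / 2) * poch (3 / 2) k * h + ((k : ℂ) + 1) * ih

lemma hasSum_pow_div_poch_half (X : ℂ) :
    HasSum (fun k : ℕ => X ^ k / poch (1 / 2) k)
      (1 + 2 * X * ∫ t in (0 : ℝ)..1, Complex.exp (X * (1 - (t : ℂ) ^ 2))) := by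
  have h := intervalIntegral.hasSum_integral_of_dominated_convergence (μ := volume)
    (a := 0) (b := 1)
    (F := fun (k : ℕ) (t : ℝ) => (X * (1 - (t : ℂ) ^ 2)) ^ k / (k.factorial : ℂ))
    (f := fun t : ℝ => Complex.exp (X * (1 - (t : ℂ) ^ 2)))
    (fun k _ => ‖X‖ ^ k / (k.factorial : ℝ))
    (fun k => Continuous.aestronglyMeasurable (by fun_prop))
    (fun k => Eventually.of_forall fun t ht => ?_)
    (Eventually.of_forall fun t _ => summable_norm_pow_div_factorial X)
    (Continuous.intervalIntegrable (by fun_prop) _ _)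
    (Eventually.of_forall fun t _ => hasSum_pow_div_factorial _)
  · rw [← hasSum_nat_add_iff' 1]
    have h0 : (1 : ℂ) + 2 * X * (∫ t in (0 : ℝ)..1, Complex.exp (X * (1 - (t : ℂ) ^ 2)))
        - ∑ i ∈ Finset.range 1, X ^ i / poch (1 / 2) i
        = 2 * X * ∫ t in (0 : ℝ)..1, Complex.exp (X * (1 - (t : ℂ) ^ 2)) := by
      simp [poch]
    rw [h0]
    convert! h.mul_left (2 * X) using 1
    funext k
    have h1 := poch_three_halves_ne_zero k
    have h2 : ∫ t in (0 : ℝ)..1, (X * (1 - (t : ℂ) ^ 2)) ^ k / (k.factorial : ℂ)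
        = X ^ k / (k.factorial : ℂ) * ((∫ t in (0 : ℝ)..1, (1 - t ^ 2) ^ k : ℝ) : ℂ) := by
      rw [← intervalIntegral.integral_ofReal, ← intervalIntegral.integral_const_mul]
      congr 1
      funext t
      push_cast
      rw [mul_pow]
      ring
    have h3 : (k.factorial : ℂ) ≠ 0 := Nat.cast_ne_zero.mpr k.factorial_ne_zero
    rw [h2, integral_one_sub_sq_pow, poch_half_succ]
    field_simp
    ring
  · rw [Set.uIoc_of_le zero_le_one] at ht
    have h1 : (1 : ℂ) - (t : ℂ) ^ 2 = ((1 - t ^ 2 : ℝ) : ℂ) := by push_cast; rfl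
    have h2 : 0 ≤ 1 - t ^ 2 := by nlinarith [ht.1, ht.2]
    rw [norm_div, norm_pow, norm_mul, h1, Complex.norm_of_nonneg h2, Complex.norm_natCast]
    gcongr
    exact mul_le_of_le_one_right (norm_nonneg _) (by nlinarith [sq_nonneg t])

lemma sqrt_pi_ne_zero : (Real.sqrt Real.pi : ℂ) ≠ 0 := by
  exact_mod_cast (Real.sqrt_pos.mpr Real.pi_pos).ne'

lemma mul_exp_mul_cerf (w : ℂ) :
    w * (Real.sqrt Real.pi : ℂ) / 2 * Complex.exp (w ^ 2 / 4) * cerf (w / 2)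
      = 2 * (w ^ 2 / 4) * ∫ t in (0 : ℝ)..1, Complex.exp (w ^ 2 / 4 * (1 - (t : ℂ) ^ 2)) := by
  have h : ∀ t : ℝ, Complex.exp (w ^ 2 / 4 * (1 - (t : ℂ) ^ 2))
      = Complex.exp (w ^ 2 / 4) * Complex.exp (-(((t : ℂ) * (w / 2)) ^ 2)) := fun t => by
    rw [← Complex.exp_add]
    congr 1
    ring
  have := sqrt_pi_ne_zero
  simp_rw [h]
  rw [cerf, intervalIntegral.integral_const_mul, intervalIntegral.integral_const_mul]
  field_simp
  ring

lemma mul_exp_neg_mul_cerfi (w : ℂ) :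
    -(w * (Real.sqrt Real.pi : ℂ) / 2 * Complex.exp (-w ^ 2 / 4) * cerfi (w / 2))
      = 2 * (-w ^ 2 / 4) * ∫ t in (0 : ℝ)..1, Complex.exp (-w ^ 2 / 4 * (1 - (t : ℂ) ^ 2)) := by
  have h : ∀ t : ℝ, Complex.exp (-w ^ 2 / 4 * (1 - (t : ℂ) ^ 2))
      = Complex.exp (-w ^ 2 / 4) * Complex.exp (((t : ℂ) * (w / 2)) ^ 2) := fun t => by
    rw [← Complex.exp_add]
    congr 1
    ring
  have := sqrt_pi_ne_zero
  simp_rw [h]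
  rw [cerfi, intervalIntegral.integral_const_mul, intervalIntegral.integral_const_mul]
  field_simp
  ring

/-! ### Assembly -/

lemma exists_exp_neg_mul_tsum_Phi3 (X : ℂ) {α : ℝ} (hα : 0 < α) :
    ∃ S : ℂ, HasSum (fun k : ℕ => (-X) ^ k / poch (1 / 2) k * (lagSum k α : ℂ)) S ∧
      Complex.exp (-X) * (∑' n : ℕ, ∑' r : ℕ,
          (sigmaNegOne (n + 1) : ℂ) * Complex.exp (-2 * ((n : ℂ) + 1) * (α : ℂ)) /
              ((r.factorial : ℂ) * poch (1 / 2) r * poch (1 / 2) (2 * r)) *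
            Phi3 (1 / 2) (1 / 2 + 2 * (r : ℂ)) X (2 * X * ((n : ℂ) + 1) * (α : ℂ)) *
            ((X * ((n : ℂ) + 1) * (α : ℂ)) ^ 2) ^ r) = ((lagSum 0 α : ℂ) + S) / 2 := by
  have hc : Summable fun k : ℕ => ‖(-X) ^ k / poch (1 / 2) k‖ * 5 ^ k := by
    refine Summable.of_nonneg_of_le (fun _ => by positivity) (fun k => ?_)
      (Real.summable_pow_div_factorial (2 * ‖-X‖ * 5))
    rw [mul_pow _ (5 : ℝ), mul_div_right_comm]
    gcongr
    exact norm_pow_div_poch_half_le (-X) k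
  obtain ⟨S, h1, h2⟩ := exists_hasSum_lagSum hα hc
    fun n => hasSum_exp_neg_mul_Phi3_half X (2 * ((n : ℝ) + 1) * α)
  refine ⟨S, h2, ?_⟩
  have h0 := Complex.hasSum_ofReal.mpr (hasSum_lambertSum hα)
  rw [lagSum_zero, ← ((h0.add h1).div_const 2).tsum_eq, ← tsum_mul_left]
  refine tsum_congr fun n => ?_
  have hr := (hasSum_Phi3_half_even X (2 * X * ((n : ℂ) + 1) * (α : ℂ))).mul_left
    ((sigmaNegOne (n + 1) : ℂ) * Complex.exp (-2 * ((n : ℂ) + 1) * (α : ℂ)))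
  have hterm : ∀ r : ℕ, (sigmaNegOne (n + 1) : ℂ) * Complex.exp (-2 * ((n : ℂ) + 1) * (α : ℂ)) /
        ((r.factorial : ℂ) * poch (1 / 2) r * poch (1 / 2) (2 * r)) *
        Phi3 (1 / 2) (1 / 2 + 2 * (r : ℂ)) X (2 * X * ((n : ℂ) + 1) * (α : ℂ)) *
        ((X * ((n : ℂ) + 1) * (α : ℂ)) ^ 2) ^ r
      = (sigmaNegOne (n + 1) : ℂ) * Complex.exp (-2 * ((n : ℂ) + 1) * (α : ℂ)) *
        (1 / ((r.factorial : ℂ) * poch (1 / 2) r * poch (1 / 2) (2 * r)) *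
        Phi3 (1 / 2) (1 / 2 + 2 * (r : ℂ)) X (2 * X * ((n : ℂ) + 1) * (α : ℂ)) *
        ((2 * X * ((n : ℂ) + 1) * (α : ℂ)) ^ 2 / 4) ^ r) := fun r => by
    rw [show (2 * X * ((n : ℂ) + 1) * (α : ℂ)) ^ 2 / 4 = (X * ((n : ℂ) + 1) * (α : ℂ)) ^ 2 by ring]
    ring
  rw [tsum_congr hterm, hr.tsum_eq]
  push_cast
  rw [show 2 * X * (2 * ((n : ℂ) + 1) * (α : ℂ)) = 2 * (2 * X * ((n : ℂ) + 1) * (α : ℂ)) by ring]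
  have he : Complex.exp (-X) * Complex.exp X = 1 := by
    rw [← Complex.exp_add, neg_add_cancel, Complex.exp_zero]
  linear_combination ((sigmaNegOne (n + 1) : ℂ)
    * Complex.exp (-2 * ((n : ℂ) + 1) * (α : ℂ)) / 2) * he

lemma hasSum_lagSum_difference {a b : ℝ} (ha : 0 < a) (hb : 0 < b) (hab : a * b = Real.pi ^ 2)
    (X : ℂ) :
    HasSum (fun k : ℕ => (-X) ^ k / poch (1 / 2) k * (lagSum k a : ℂ)
        - X ^ k / poch (1 / 2) k * (lagSum k b : ℂ))
      ((2 * -X * hyp2F2 1 1 (3 / 2) 2 (-X) - 2 * X * hyp2F2 1 1 (3 / 2) 2 X) / 2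
        + (b * (1 + 2 * X * ∫ t in (0 : ℝ)..1, Complex.exp (X * (1 - (t : ℂ) ^ 2)))
          - a * (1 + 2 * -X * ∫ t in (0 : ℝ)..1, Complex.exp (-X * (1 - (t : ℂ) ^ 2)))) / 6
        + ((Real.log (a / Real.pi) / 2 - (b - a) / 12 : ℝ) : ℂ)) := by
  have h1 := ((hasSum_pow_div_mul_poch_half (-X)).sub
    (hasSum_pow_div_mul_poch_half X)).div_const 2
  have h2 := (((hasSum_pow_div_poch_half X).mul_left (b : ℂ)).sub
    ((hasSum_pow_div_poch_half (-X)).mul_left (a : ℂ))).div_const 6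
  have h3 := hasSum_ite_eq (0 : ℕ) ((Real.log (a / Real.pi) / 2 - (b - a) / 12 : ℝ) : ℂ)
  convert! (h1.add h2).add h3 using 1
  funext k
  have h := congrArg (fun r : ℝ => (r : ℂ)) (lagSum_sub_lagSum ha hb hab k)
  have hs : ((-1 : ℂ) ^ k) * (-1) ^ k = 1 := by rw [← mul_pow]; norm_num
  have hp := poch_half_ne_zero k
  rw [neg_pow X]
  split_ifs at h ⊢ with hk
  · subst hk
    simp only [pow_zero, Nat.cast_zero] at h ⊢
    simp only [poch, Finset.range_zero, Finset.prod_empty]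
    push_cast at h ⊢
    linear_combination h
  · have hk' : (k : ℂ) ≠ 0 := Nat.cast_ne_zero.mpr hk
    push_cast at h ⊢
    have h' : (lagSum k a : ℂ) = (-1) ^ k * lagSum k b + ((1 - (-1) ^ k) / (2 * (k : ℂ))
        + (b * (-1) ^ k - a) / 6) := by linear_combination h
    rw [h']
    field_simp
    linear_combination (6 * (k : ℂ) * X ^ k * lagSum k b * 2 - 6 * X ^ k  + 2 * k * b * X ^ k) * hs
/-- generalization of the transformation formula for `log η(z)`. -/
theorem gen_dedekind_eta_transformation (w : ℂ) (a b : ℝ) (ha : 0 < a) (hb : 0 < b)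
    (hab : a * b = Real.pi ^ 2) :
    Complex.exp (-w^2/4) *
        (∑' n : ℕ, ∑' r : ℕ,
          (sigmaNegOne (n+1) : ℂ) * Complex.exp (-2 * ((n:ℂ)+1) * (a:ℂ)) /
              ((r.factorial : ℂ) * poch (1/2) r * poch (1/2) (2*r)) *
            Phi3 (1/2) (1/2 + 2*(r:ℂ)) (w^2/4) (w^2 * ((n:ℂ)+1) * (a:ℂ) / 2) *
            (w^4 * ((n:ℂ)+1)^2 * (a:ℂ)^2 / 16) ^ r)
      - Complex.exp (w^2/4) *
        (∑' n : ℕ, ∑' r : ℕ,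
          (sigmaNegOne (n+1) : ℂ) * Complex.exp (-2 * ((n:ℂ)+1) * (b:ℂ)) /
              ((r.factorial : ℂ) * poch (1/2) r * poch (1/2) (2*r)) *
            Phi3 (1/2) (1/2 + 2*(r:ℂ)) (-w^2/4) (-w^2 * ((n:ℂ)+1) * (b:ℂ) / 2) *
            (w^4 * ((n:ℂ)+1)^2 * (b:ℂ)^2 / 16) ^ r)
    = (1/4) * ((Real.log (a/b) : ℂ) - w^2/2 *
          (hyp2F2 1 1 (3/2) 2 (w^2/4) + hyp2F2 1 1 (3/2) 2 (-w^2/4)))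
      + (1/12) * ((b:ℂ) * (1 + w * (Real.sqrt Real.pi : ℂ) / 2 * Complex.exp (w^2/4) * cerf (w/2))
          - (a:ℂ) * (1 - w * (Real.sqrt Real.pi : ℂ) / 2 * Complex.exp (-w^2/4) * cerfi (w/2))) := by
  obtain ⟨S, hS, hA⟩ := exists_exp_neg_mul_tsum_Phi3 (w ^ 2 / 4) ha
  obtain ⟨T, hT, hB⟩ := exists_exp_neg_mul_tsum_Phi3 (-w ^ 2 / 4) hb
  have hLa : Complex.exp (-w^2/4) *
        (∑' n : ℕ, ∑' r : ℕ,
          (sigmaNegOne (n+1) : ℂ) * Complex.exp (-2 * ((n:ℂ)+1) * (a:ℂ)) /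
              ((r.factorial : ℂ) * poch (1/2) r * poch (1/2) (2*r)) *
            Phi3 (1/2) (1/2 + 2*(r:ℂ)) (w^2/4) (w^2 * ((n:ℂ)+1) * (a:ℂ) / 2) *
            (w^4 * ((n:ℂ)+1)^2 * (a:ℂ)^2 / 16) ^ r) = ((lagSum 0 a : ℂ) + S) / 2 := by
    rw [← hA, neg_div]
    congr 1
    refine tsum_congr fun n => tsum_congr fun r => ?_
    rw [show 2 * (w ^ 2 / 4) * ((n : ℂ) + 1) * (a : ℂ) = w^2 * ((n:ℂ)+1) * (a:ℂ) / 2 by ring,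
      show (w ^ 2 / 4 * ((n : ℂ) + 1) * (a : ℂ)) ^ 2 = w^4 * ((n:ℂ)+1)^2 * (a:ℂ)^2 / 16 by ring]
  have hLb : Complex.exp (w^2/4) *
        (∑' n : ℕ, ∑' r : ℕ,
          (sigmaNegOne (n+1) : ℂ) * Complex.exp (-2 * ((n:ℂ)+1) * (b:ℂ)) /
              ((r.factorial : ℂ) * poch (1/2) r * poch (1/2) (2*r)) *
            Phi3 (1/2) (1/2 + 2*(r:ℂ)) (-w^2/4) (-w^2 * ((n:ℂ)+1) * (b:ℂ) / 2) *
            (w^4 * ((n:ℂ)+1)^2 * (b:ℂ)^2 / 16) ^ r) = ((lagSum 0 b : ℂ) + T) / 2 := by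
    rw [← hB, show -(-w ^ 2 / 4) = w ^ 2 / 4 by ring]
    congr 1
    refine tsum_congr fun n => tsum_congr fun r => ?_
    rw [show 2 * (-w ^ 2 / 4) * ((n : ℂ) + 1) * (b : ℂ) = -w^2 * ((n:ℂ)+1) * (b:ℂ) / 2 by ring,
      show (-w ^ 2 / 4 * ((n : ℂ) + 1) * (b : ℂ)) ^ 2 = w^4 * ((n:ℂ)+1)^2 * (b:ℂ)^2 / 16 by ring]
  rw [hLa, hLb]
  have hX : -(-w ^ 2 / 4) = w ^ 2 / 4 := by ring
  have hX' : -(w ^ 2 / 4) = -w ^ 2 / 4 := by ring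
  have hD := hasSum_lagSum_difference ha hb hab (w ^ 2 / 4)
  rw [hX] at hT
  have hST := (hS.sub hT).unique hD
  have h0 := congrArg (fun r : ℝ => (r : ℂ)) (lambertSum_sub_lambertSum ha hb hab)
  have hlog : Real.log (a / b) = 2 * Real.log (a / Real.pi) := by
    have h : a / b = (a / Real.pi) ^ 2 := by
      rw [div_pow, ← hab]
      field_simp
    rw [h, Real.log_pow]
    norm_num
  have herf := mul_exp_mul_cerf w
  have herfi := mul_exp_neg_mul_cerfi w
  rw [hX'] at hST
  rw [lagSum_zero, lagSum_zero, hlog]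
  push_cast at h0 hST ⊢
  linear_combination h0 / 2 + hST / 2 - (b / 12 : ℂ) * herf + (a / 12 : ℂ) * herfi

end
end

section
/- Let $n\in\mathbb{N}\cup\{0\}$ and let $s\in\mathbb{C}$ with $\frac12<\mathrm{Re}(s)<1$. Then $\int_{0}^{\infty}{}_1F_1\!\left(\frac12;\frac12-n;-x\right)x^{s-\frac32}\,dx=\frac{(-1)^n}{\sqrt{\pi}}\,\frac{\Gamma\!\left(\frac12-n\right)\Gamma\!\left(s-\frac12\right)\Gamma(s+n)}{\Gamma(s)}$. -/
open Complex MeasureTheory Filter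

noncomputable section

/-- The power series of `₁F₁(a;c;z)` in `z`. -/
def hyp1F1Series (a c : ℂ) : PowerSeries ℂ :=
  PowerSeries.mk fun m => poch a m / (poch c m * (m.factorial : ℂ))

lemma poch_mul_add (c : ℂ) (m : ℕ) : poch c m * (c + m) = c * poch (c + 1) m := by
  have h := (Finset.prod_range_succ (fun i : ℕ => c + (i : ℂ)) m).symm.trans
    (Finset.prod_range_succ' (fun i : ℕ => c + (i : ℂ)) m)
  simp only [poch, h, Nat.cast_add, Nat.cast_one, Nat.cast_zero, add_zero]
  rw [mul_comm]
  congr 1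
  exact Finset.prod_congr rfl fun i _ => by ring

/-- Lowering the lower parameter acts on the series as `1 + c⁻¹ z d/dz`. -/
lemma hyp1F1Series_lower (a c : ℂ) (hc : ∀ m : ℕ, c + m ≠ 0) :
    hyp1F1Series a c = hyp1F1Series a (c + 1) +
      PowerSeries.C c⁻¹ * (PowerSeries.X * PowerSeries.derivative ℂ (hyp1F1Series a (c + 1))) := by
  have hc0 : c ≠ 0 := by simpa using hc 0
  have hp : ∀ m, poch (c + 1) m ≠ 0 := fun m =>
    Finset.prod_ne_zero_iff.2 fun i _ => by
      have := hc (i + 1)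
      push_cast at this
      rwa [add_assoc, add_comm 1]
  have hq : ∀ m, poch c m ≠ 0 := fun m => Finset.prod_ne_zero_iff.2 fun i _ => hc i
  ext m
  have hX : PowerSeries.coeff m
      (PowerSeries.X * PowerSeries.derivative ℂ (hyp1F1Series a (c + 1))) =
      m * PowerSeries.coeff m (hyp1F1Series a (c + 1)) := by
    cases m with
    | zero => simp
    | succ k =>
      rw [PowerSeries.coeff_succ_X_mul, PowerSeries.coeff_derivative]
      push_cast
      ring
  rw [map_add, PowerSeries.coeff_C_mul, hX]
  simp only [hyp1F1Series, PowerSeries.coeff_mk]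
  have h := poch_mul_add c m
  have hm : (m.factorial : ℂ) ≠ 0 := by exact_mod_cast m.factorial_ne_zero
  have hpm := hp m
  have hqm := hq m
  field_simp
  linear_combination (-poch a m) * h

lemma hasSum_coeff_polynomial_mul_exp (P : Polynomial ℂ) (z : ℂ) :
    HasSum (fun m => PowerSeries.coeff m ((P : PowerSeries ℂ) * PowerSeries.exp ℂ) * z ^ m)
      (P.eval z * Complex.exp z) := by
  induction P using Polynomial.induction_on' with
  | add p q hp hq =>
    simpa [add_mul] using hp.add hq
  | monomial k a =>
    have he : HasSum (fun m : ℕ => z ^ m / (m.factorial : ℂ)) (Complex.exp z) := by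
      rw [Complex.exp_eq_exp_ℂ]
      exact NormedSpace.expSeries_div_hasSum_exp z
    have hcoe : ((Polynomial.monomial k a : Polynomial ℂ) : PowerSeries ℂ) =
        PowerSeries.C a * PowerSeries.X ^ k := by
      rw [← Polynomial.C_mul_X_pow_eq_monomial]
      simp
    rw [hcoe, ← hasSum_nat_add_iff' k, Finset.sum_eq_zero, sub_zero]
    · convert! he.mul_left (a * z ^ k) using 1
      · ext m
        rw [mul_assoc, PowerSeries.coeff_C_mul, PowerSeries.coeff_X_pow_mul]
        simp [PowerSeries.coeff_exp, pow_add]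
        ring
      · simp
    · intro m hm
      rw [mul_assoc, PowerSeries.coeff_C_mul, PowerSeries.coeff_X_pow_mul',
        if_neg (by simpa using hm)]
      simp

lemma hyp1F1_eq_polynomial_mul_exp {a c : ℂ} {P : Polynomial ℂ}
    (h : hyp1F1Series a c = (P : PowerSeries ℂ) * PowerSeries.exp ℂ) (z : ℂ) :
    hyp1F1 a c z = P.eval z * Complex.exp z := by
  rw [← (hasSum_coeff_polynomial_mul_exp P z).tsum_eq, ← h]
  simp [hyp1F1, hyp1F1Series]

/-- The Mellin transform of `P(-x) e⁻ˣ` at `t`, computed termwise. -/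
def gammaMellin (t : ℂ) (P : Polynomial ℂ) : ℂ :=
  P.sum fun k a => a * ((-1) ^ k * Complex.Gamma (t + k))

lemma gammaMellin_add (t : ℂ) (P Q : Polynomial ℂ) :
    gammaMellin t (P + Q) = gammaMellin t P + gammaMellin t Q :=
  Polynomial.sum_add_index P Q _ (by simp) fun _ _ _ => add_mul _ _ _

lemma gammaMellin_monomial (t : ℂ) (k : ℕ) (a : ℂ) :
    gammaMellin t (Polynomial.monomial k a) = a * ((-1) ^ k * Complex.Gamma (t + k)) :=
  Polynomial.sum_monomial_index _ _ (by simp)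

lemma gammaMellin_C_mul (t b : ℂ) (P : Polynomial ℂ) :
    gammaMellin t (Polynomial.C b * P) = b * gammaMellin t P := by
  induction P using Polynomial.induction_on' with
  | add p q hp hq => rw [mul_add, gammaMellin_add, hp, hq, gammaMellin_add, mul_add]
  | monomial k a => rw [Polynomial.C_mul_monomial, gammaMellin_monomial, gammaMellin_monomial,
      mul_assoc]

/-- The Euler operator `x d/dx` acts on Mellin transforms as multiplication by `-t`. -/
lemma gammaMellin_euler {t : ℂ} (ht : 0 < t.re) (P : Polynomial ℂ) :
    gammaMellin t (Polynomial.X * (Polynomial.derivative P + P)) = -t * gammaMellin t P := by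
  induction P using Polynomial.induction_on' with
  | add p q hp hq =>
    rw [gammaMellin_add, mul_add (-t), ← hp, ← hq, ← gammaMellin_add]
    congr 1
    simp only [map_add]
    ring
  | monomial k a =>
    have htk : t + k ≠ 0 := fun h => by
      have := congrArg Complex.re h
      simp only [add_re, natCast_re, zero_re] at this
      have : (0 : ℝ) ≤ k := k.cast_nonneg
      linarith
    have hX : Polynomial.X * (Polynomial.derivative (Polynomial.monomial k a) +
        Polynomial.monomial k a) =
        Polynomial.monomial k (k * a) + Polynomial.monomial (k + 1) a := by
      rw [mul_add, Polynomial.X_mul_monomial, Polynomial.derivative_monomial,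
        Polynomial.X_mul_monomial]
      cases k with
      | zero => simp
      | succ k => simp [mul_comm]
    rw [hX, gammaMellin_add]
    simp only [gammaMellin_monomial]
    have hG := Complex.Gamma_add_one _ htk
    push_cast
    rw [← add_assoc, hG]
    ring

lemma integral_polynomial_mul_exp_mul_cpow {t : ℂ} (ht : 0 < t.re) (P : Polynomial ℂ) :
    IntegrableOn (fun x : ℝ => P.eval (-(x : ℂ)) * Complex.exp (-(x : ℂ)) * (x : ℂ) ^ (t - 1))
        (Set.Ioi 0) ∧
      ∫ x in Set.Ioi (0 : ℝ), P.eval (-(x : ℂ)) * Complex.exp (-(x : ℂ)) * (x : ℂ) ^ (t - 1) =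
        gammaMellin t P := by
  induction P using Polynomial.induction_on' with
  | add p q hp hq =>
    simp only [Polynomial.eval_add, add_mul]
    exact ⟨hp.1.add hq.1, by rw [integral_add hp.1 hq.1, hp.2, hq.2, gammaMellin_add]⟩
  | monomial k a =>
    have htk : 0 < (t + k).re := by
      simp only [add_re, natCast_re]
      positivity
    have heq : Set.EqOn (fun x : ℝ => a * (-1) ^ k *
          (((-x).exp : ℝ) * (x : ℂ) ^ (t + k - 1)))
        (fun x : ℝ => (Polynomial.monomial k a).eval (-(x : ℂ)) * Complex.exp (-(x : ℂ)) *
          (x : ℂ) ^ (t - 1)) (Set.Ioi 0) := by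
      intro x hx
      have hx0 : (x : ℂ) ≠ 0 := by exact_mod_cast (Set.mem_Ioi.1 hx).ne'
      simp only [Polynomial.eval_monomial]
      rw [neg_pow (x : ℂ), show t + k - 1 = (t - 1) + k by ring, Complex.cpow_add _ _ hx0,
        Complex.cpow_natCast]
      push_cast
      ring
    have hint := (Complex.GammaIntegral_convergent htk).const_mul (a * (-1) ^ k)
    refine ⟨IntegrableOn.congr_fun hint heq measurableSet_Ioi, ?_⟩
    rw [← setIntegral_congr_fun measurableSet_Ioi heq, integral_const_mul, gammaMellin_monomial,
      Complex.Gamma_eq_integral htk, Complex.GammaIntegral, mul_assoc]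

lemma half_sub_natCast_add_natCast_ne_zero (n m : ℕ) : (1 / 2 - (n : ℂ)) + m ≠ 0 := by
  intro h
  have h2 : ((1 + 2 * m : ℕ) : ℂ) = ((2 * n : ℕ) : ℂ) := by
    push_cast
    linear_combination 2 * h
  have := Nat.cast_injective h2
  omega

/-- `₁F₁(1/2; 1/2 - n; z)` is a polynomial times `eᶻ`, with explicit termwise Mellin transform. -/
lemma exists_polynomial_hyp1F1Series_half (n : ℕ) (s : ℂ) (hs : 1 / 2 < s.re) :
    ∃ P : Polynomial ℂ,
      hyp1F1Series (1 / 2) (1 / 2 - (n : ℂ)) = (P : PowerSeries ℂ) * PowerSeries.exp ℂ ∧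
      gammaMellin (s - 1 / 2) P = (-1) ^ n / (Real.sqrt Real.pi : ℂ) *
          (Complex.Gamma (1 / 2 - (n : ℂ)) * Complex.Gamma (s - 1 / 2) * Complex.Gamma (s + n)
            / Complex.Gamma s) := by
  have ht : 0 < (s - 1 / 2).re := by
    norm_num
    linarith
  induction n with
  | zero =>
    refine ⟨1, ?_, ?_⟩
    · ext m
      have hp : poch (1 / 2) m ≠ 0 := Finset.prod_ne_zero_iff.2 fun i _ => by
        simpa using half_sub_natCast_add_natCast_ne_zero 0 i
      simp only [hyp1F1Series, PowerSeries.coeff_mk, Nat.cast_zero, sub_zero, Polynomial.coe_one,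
        one_mul, PowerSeries.coeff_exp]
      rw [← div_div, div_self hp]
      simp
    · have hG : Complex.Gamma (1 / 2) = (Real.sqrt Real.pi : ℂ) := by
        rw [← Real.Gamma_one_half_eq, ← Complex.Gamma_ofReal]
        simp
      have hpi : (Real.sqrt Real.pi : ℂ) ≠ 0 := by
        exact_mod_cast (Real.sqrt_pos.2 Real.pi_pos).ne'
      have hGs : Complex.Gamma s ≠ 0 := Complex.Gamma_ne_zero_of_re_pos (by linarith)
      rw [← Polynomial.C_1, ← Polynomial.monomial_zero_left, gammaMellin_monomial]
      simp only [Nat.cast_zero, sub_zero, add_zero, pow_zero, hG]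
      field_simp
  | succ n ih =>
    obtain ⟨P, hP, hM⟩ := ih
    set c : ℂ := 1 / 2 - ((n + 1 : ℕ) : ℂ) with hc
    have hc1 : 1 / 2 - (n : ℂ) = c + 1 := by
      rw [hc]
      push_cast
      ring
    have hcm : ∀ m : ℕ, c + m ≠ 0 := half_sub_natCast_add_natCast_ne_zero (n + 1)
    have hc0 : c ≠ 0 := by simpa using hcm 0
    have hsn : s + n ≠ 0 := fun h => by
      have := congrArg Complex.re h
      simp only [add_re, natCast_re, zero_re] at this
      have : (0 : ℝ) ≤ n := n.cast_nonneg
      linarith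
    rw [hc1] at hP hM
    refine ⟨P + Polynomial.C c⁻¹ * (Polynomial.X * (Polynomial.derivative P + P)), ?_, ?_⟩
    · rw [hyp1F1Series_lower _ _ hcm, hP, Derivation.leibniz, PowerSeries.derivative_exp,
        PowerSeries.derivative_coe]
      simp only [Polynomial.coe_add, Polynomial.coe_mul, Polynomial.coe_C, Polynomial.coe_X,
        smul_eq_mul]
      ring
    · rw [gammaMellin_add, gammaMellin_C_mul, gammaMellin_euler ht, hM,
        Complex.Gamma_add_one _ hc0]
      have hG := Complex.Gamma_add_one _ hsn
      push_cast
      rw [← add_assoc, hG, pow_succ]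
      have hn : (n : ℂ) = -c - 1 / 2 := by
        rw [hc]
        push_cast
        ring
      rw [hn]
      field_simp
      ring

/-- Mellin transform of `₁F₁(1/2; 1/2 - n; -x)` (Lemma 2.1, equation (2.8)). -/
theorem mellin_transform_1F1 (n : ℕ) (s : ℂ) (hs1 : 1/2 < s.re) (hs2 : s.re < 1) :
    ∫ x in Set.Ioi (0:ℝ), hyp1F1 (1/2) (1/2 - (n:ℂ)) (-(x:ℂ)) * (x:ℂ) ^ (s - 3/2)
      = (-1)^n / (Real.sqrt Real.pi : ℂ) *
          (Complex.Gamma (1/2 - (n:ℂ)) * Complex.Gamma (s - 1/2) * Complex.Gamma (s + n)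
            / Complex.Gamma s) := by
  obtain ⟨P, hP, hM⟩ := exists_polynomial_hyp1F1Series_half n s hs1
  have ht : 0 < (s - 1 / 2).re := by
    norm_num
    linarith
  rw [← hM, ← (integral_polynomial_mul_exp_mul_cpow ht P).2]
  simp only [hyp1F1_eq_polynomial_mul_exp hP, show s - 1 / 2 - 1 = s - 3 / 2 by ring]

end
end

section
/- Let $x\in\mathbb{C}\setminus\{x\in\mathbb{R}:x\le 0\}$, and let $n,m\in\mathbb{N}\cup\{0\}$. Then $\lim_{s\to \frac12-m}\left(s-\left(\frac12-m\right)\right)\frac{\Gamma\!\left(s-\frac12\right)\Gamma(s+n)}{\Gamma(s)}\,x^{-s}=\frac{(-1)^m}{m!}\,\frac{\Gamma\!\left(n-m+\frac12\right)}{\Gamma\!\left(\frac12-m\right)}\,x^{m-\frac12}$; that is, the residue of $s\mapsto\frac{\Gamma(s-\frac12)\Gamma(s+n)}{\Gamma(s)}x^{-s}$ at its simple pole $s=\frac12-m$ equals $\frac{(-1)^m}{m!}\frac{\Gamma(n-m+\frac12)}{\Gamma(\frac12-m)}x^{m-\frac12}$. -/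
open Complex MeasureTheory Filter

noncomputable section

/-- The Gamma function has a simple pole at `-m` with residue `(-1)^m / m!`. -/
theorem tendsto_add_nat_mul_Gamma_nhds_neg_nat (m : ℕ) :
    Tendsto (fun z : ℂ => (z + m) * Complex.Gamma z) (nhdsWithin (-(m : ℂ)) {-(m : ℂ)}ᶜ)
      (nhds ((-1) ^ m / (m.factorial : ℂ))) := by
  induction m with
  | zero => simpa using Complex.tendsto_self_mul_Gamma_nhds_zero
  | succ k ih =>
    have hk : (k : ℂ) + 1 ≠ 0 := Nat.cast_add_one_ne_zero k
    have hne : -((k + 1 : ℕ) : ℂ) ≠ 0 := by simpa using neg_ne_zero.mpr hk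
    have hshift : Tendsto (fun z : ℂ => z + 1)
        (nhdsWithin (-((k + 1 : ℕ) : ℂ)) {-((k + 1 : ℕ) : ℂ)}ᶜ)
        (nhdsWithin (-(k : ℂ)) {-(k : ℂ)}ᶜ) := by
      refine tendsto_nhdsWithin_iff.mpr ⟨?_, ?_⟩
      · have h : Tendsto (fun z : ℂ => z + 1) (nhds (-((k + 1 : ℕ) : ℂ)))
            (nhds (-((k + 1 : ℕ) : ℂ) + 1)) := (continuous_id.add continuous_const).tendsto _
        have he : -((k + 1 : ℕ) : ℂ) + 1 = -(k : ℂ) := by push_cast; ring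
        rw [he] at h
        exact h.mono_left nhdsWithin_le_nhds
      · filter_upwards [self_mem_nhdsWithin] with z hz hzk
        refine hz ?_
        rw [Set.mem_singleton_iff] at hzk ⊢
        push_cast
        linear_combination hzk
    have hid : Tendsto (fun z : ℂ => z)
        (nhdsWithin (-((k + 1 : ℕ) : ℂ)) {-((k + 1 : ℕ) : ℂ)}ᶜ)
        (nhds (-((k + 1 : ℕ) : ℂ))) := tendsto_id.mono_left nhdsWithin_le_nhds
    have hlim := (ih.comp hshift).div hid hne
    have hval : (-1) ^ k / (k.factorial : ℂ) / -((k + 1 : ℕ) : ℂ)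
        = (-1) ^ (k + 1) / ((k + 1).factorial : ℂ) := by
      have hf : (k.factorial : ℂ) ≠ 0 := Nat.cast_ne_zero.mpr k.factorial_ne_zero
      rw [Nat.factorial_succ]
      push_cast
      field_simp
      ring
    rw [hval] at hlim
    refine hlim.congr' ?_
    filter_upwards [nhdsWithin_le_nhds (isOpen_ne.mem_nhds hne)] with z hz
    have hz' : z ≠ 0 := hz
    simp only [Pi.div_apply, Function.comp_apply, Complex.Gamma_add_one z hz']
    push_cast
    field_simp
    ring

/-- A half-integer is not a nonpositive integer. -/
theorem half_add_int_ne_neg_nat (j : ℤ) (k : ℕ) : (1 / 2 + (j : ℂ)) ≠ -(k : ℂ) := by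
  intro h
  have h2 : ((1 + 2 * j + 2 * k : ℤ) : ℂ) = 0 := by
    push_cast
    linear_combination 2 * h
  have h3 : 1 + 2 * j + 2 * (k : ℤ) = 0 := by exact_mod_cast h2
  omega

/-- residue of `Γ(s-1/2)Γ(s+n)/Γ(s) · x^{-s}` at the simple pole `s = 1/2 - m`. -/
theorem residue_at_half_sub_m (x : ℂ) (hx : ∀ r : ℝ, r ≤ 0 → x ≠ (r : ℂ)) (n m : ℕ) :
    Filter.Tendsto
      (fun s : ℂ => (s - (1/2 - (m:ℂ))) *
        (Complex.Gamma (s - 1/2) * Complex.Gamma (s + n) / Complex.Gamma s * x ^ (-s)))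
      (nhdsWithin (1/2 - (m:ℂ)) {(1/2 - (m:ℂ))}ᶜ)
      (nhds ((-1)^m / (m.factorial : ℂ) *
        (Complex.Gamma ((n:ℂ) - (m:ℂ) + 1/2) / Complex.Gamma (1/2 - (m:ℂ))) *
        x ^ ((m:ℂ) - 1/2))) := by
  have hx0 : x ≠ 0 := by simpa using hx 0 le_rfl
  have hpole : ∀ k : ℕ, (1 / 2 - (m : ℂ)) ≠ -(k : ℂ) := fun k => by
    simpa [sub_eq_add_neg] using half_add_int_ne_neg_nat (-(m : ℤ)) k
  have hpole_add : ∀ k : ℕ, (1 / 2 - (m : ℂ)) + n ≠ -(k : ℂ) := fun k => by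
    simpa [sub_eq_add_neg, add_assoc] using half_add_int_ne_neg_nat (-(m : ℤ) + n) k
  have hshift : Tendsto (fun s : ℂ => s - 1 / 2)
      (nhdsWithin (1 / 2 - (m : ℂ)) {(1 / 2 - (m : ℂ))}ᶜ)
      (nhdsWithin (-(m : ℂ)) {-(m : ℂ)}ᶜ) := by
    refine tendsto_nhdsWithin_iff.mpr ⟨?_, ?_⟩
    · have h : Tendsto (fun s : ℂ => s - 1 / 2) (nhds (1 / 2 - (m : ℂ)))
          (nhds (1 / 2 - (m : ℂ) - 1 / 2)) := (continuous_id.sub continuous_const).tendsto _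
      have he : 1 / 2 - (m : ℂ) - 1 / 2 = -(m : ℂ) := by ring
      rw [he] at h
      exact h.mono_left nhdsWithin_le_nhds
    · filter_upwards [self_mem_nhdsWithin] with s hs hsm
      refine hs ?_
      rw [Set.mem_singleton_iff] at hsm ⊢
      linear_combination hsm
  have hres := (tendsto_add_nat_mul_Gamma_nhds_neg_nat m).comp hshift
  have hcont : ContinuousAt
      (fun s : ℂ => Complex.Gamma (s + n) / Complex.Gamma s * x ^ (-s)) (1 / 2 - (m : ℂ)) := by
    have hnum : ContinuousAt (fun s : ℂ => Complex.Gamma (s + n)) (1 / 2 - (m : ℂ)) :=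
      ContinuousAt.comp (f := fun s : ℂ => s + n) (g := Complex.Gamma)
        (Complex.differentiableAt_Gamma _ hpole_add).continuousAt
        (continuous_id.add continuous_const).continuousAt
    exact (hnum.div (Complex.differentiableAt_Gamma _ hpole).continuousAt
      (Complex.Gamma_ne_zero hpole)).mul
        (continuousAt_id.neg.const_cpow (Or.inl hx0))
  have hlim := hres.mul (hcont.tendsto.mono_left nhdsWithin_le_nhds)
  have harg : (1 / 2 - (m : ℂ)) + n = n - m + 1 / 2 := by ring
  have hexp : -(1 / 2 - (m : ℂ)) = m - 1 / 2 := by ring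
  rw [harg, hexp, ← mul_assoc] at hlim
  refine hlim.congr fun s => ?_
  simp only [Function.comp_apply]
  ring

end
end

section
/- Let $w\in\mathbb{C}$ and $x\in\mathbb{C}$. Then the series $\sum_{r=0}^{\infty}\frac{\left(\frac{w^{4}x^{2}}{64}\right)^{r}}{r!\,(\tfrac12)_r\,(\tfrac12)_{2r}}\,\Phi_3\!\left(\tfrac12;\tfrac12+2r;-\tfrac{w^2}{4},-\tfrac{w^2 x}{4}\right)$ converges (is summable). -/
open Complex MeasureTheory Filter

noncomputable section

theorem norm_poch (a : ℂ) (m : ℕ) : ‖poch a m‖ = ∏ i ∈ Finset.range m, ‖a + i‖ :=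
  norm_prod _ _

theorem norm_half_add (r i : ℕ) : ‖(1 / 2 + 2 * (r : ℂ)) + i‖ = 1 / 2 + 2 * (r : ℝ) + i := by
  have h : (1 / 2 + 2 * (r : ℂ)) + i = ((1 / 2 + 2 * (r : ℝ) + i : ℝ) : ℂ) := by push_cast; rfl
  rw [h, Complex.norm_of_nonneg (by positivity)]

/-- Comparison of Pochhammer symbols with base points `1/2` and `1/2 + 2r`. -/
theorem norm_poch_half_mul_pow_le (r m n : ℕ) :
    ‖poch (1 / 2) m‖ * (1 / 2) ^ n ≤ ‖poch (1 / 2 + 2 * (r : ℂ)) (m + n)‖ := by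
  rw [norm_poch, norm_poch, Finset.prod_range_add]
  gcongr ?_ * ?_
  · refine Finset.prod_le_prod (fun i _ => norm_nonneg _) fun i _ => ?_
    have h := norm_half_add 0 i
    simp only [Nat.cast_zero, mul_zero, add_zero] at h
    rw [h, norm_half_add]
    have : (0 : ℝ) ≤ r := r.cast_nonneg
    linarith
  · calc (1 / 2 : ℝ) ^ n = ∏ _i ∈ Finset.range n, (1 / 2 : ℝ) := by simp
      _ ≤ _ := Finset.prod_le_prod (fun _ _ => by norm_num) fun i _ => by
        rw [norm_half_add, add_assoc]
        exact le_add_of_nonneg_right (by positivity)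

theorem pow_half_le_norm_poch_half (n : ℕ) : (1 / 2 : ℝ) ^ n ≤ ‖poch (1 / 2) n‖ := by
  simpa [poch] using norm_poch_half_mul_pow_le 0 0 n

theorem norm_Phi3_half_le (r : ℕ) (x y : ℂ) :
    ‖Phi3 (1 / 2) (1 / 2 + 2 * (r : ℂ)) x y‖ ≤ Real.exp ‖x‖ * Real.exp (2 * ‖y‖) := by
  have hsum : HasSum (fun p : ℕ × ℕ =>
      ‖x‖ ^ p.1 / (p.1.factorial : ℝ) * ((2 * ‖y‖) ^ p.2 / (p.2.factorial : ℝ)))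
      (Real.exp ‖x‖ * Real.exp (2 * ‖y‖)) := by
    have h (t : ℝ) : HasSum (fun n : ℕ => t ^ n / (n.factorial : ℝ)) (Real.exp t) := by
      rw [Real.exp_eq_exp_ℝ]
      exact NormedSpace.expSeries_div_hasSum_exp t
    exact (h _).mul (h _) ((Real.summable_pow_div_factorial _).mul_of_nonneg
      (Real.summable_pow_div_factorial _) (fun _ => by positivity) (fun _ => by positivity))
  refine tsum_of_norm_bounded hsum fun ⟨m, n⟩ => ?_
  have hm : 0 < ‖poch (1 / 2) m‖ := (by positivity : (0 : ℝ) < (1 / 2) ^ m).trans_le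
    (pow_half_le_norm_poch_half m)
  have hratio : ‖poch (1 / 2) m‖ / ‖poch (1 / 2 + 2 * (r : ℂ)) (m + n)‖ ≤ 2 ^ n := by
    have h := norm_poch_half_mul_pow_le r m n
    rw [div_le_iff₀ ((by positivity : (0 : ℝ) < _).trans_le h)]
    calc ‖poch (1 / 2) m‖ = 2 ^ n * (‖poch (1 / 2) m‖ * (1 / 2) ^ n) := by
          rw [mul_left_comm, ← mul_pow]; norm_num
      _ ≤ _ := by gcongr
  simp only [norm_mul, norm_div, norm_pow, Complex.norm_natCast]
  calc _ = ‖poch (1 / 2) m‖ / ‖poch (1 / 2 + 2 * (r : ℂ)) (m + n)‖ *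
        (‖x‖ ^ m / m.factorial * (‖y‖ ^ n / n.factorial)) := by
          simp only [div_eq_mul_inv, mul_inv]; ring
    _ ≤ 2 ^ n * (‖x‖ ^ m / m.factorial * (‖y‖ ^ n / n.factorial)) := by gcongr
    _ = _ := by rw [mul_pow]; ring

/-- summability of the series of Humbert functions appearing in
the formula for `K_{1/2,w}(x)`. -/
theorem humbert_series_summable (w x : ℂ) :
    Summable (fun r : ℕ => (w^4 * x^2 / 64) ^ r /
        ((r.factorial : ℂ) * poch (1/2) r * poch (1/2) (2*r)) *
      Phi3 (1/2) (1/2 + 2*(r:ℂ)) (-w^2 / 4) (-w^2 * x / 4)) := by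
  set z := w^4 * x^2 / 64
  refine Summable.of_norm_bounded
    ((Real.summable_pow_div_factorial (8 * ‖z‖)).mul_right
      (Real.exp ‖-w^2 / 4‖ * Real.exp (2 * ‖-w^2 * x / 4‖))) fun r => ?_
  rw [norm_mul]
  gcongr ?_ * ?_
  · simp only [norm_mul, norm_div, norm_pow, Complex.norm_natCast]
    calc _ ≤ ‖z‖ ^ r / (r.factorial * (1 / 2 : ℝ) ^ r * (1 / 2 : ℝ) ^ (2 * r)) := by
          gcongr <;> exact pow_half_le_norm_poch_half _
      _ = (8 * ‖z‖) ^ r / r.factorial := by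
          rw [mul_assoc, ← pow_add, show r + 2 * r = 3 * r by ring, pow_mul, mul_pow,
            show (1 / 2 : ℝ) ^ 3 = 8⁻¹ by norm_num, inv_pow]
          field_simp
  · exact norm_Phi3_half_le r _ _

end
end

section
/- Let $x,y\in\mathbb{C}$ be fixed. Then $\lim_{r\to\infty}\Phi_3\!\left(\tfrac12;\tfrac12+2r;x,y\right)=1$, where $r$ runs over the nonnegative integers. -/
open Complex MeasureTheory Filter

noncomputable section

lemma norm_poch_ofReal {a : ℝ} (ha : 0 ≤ a) (m : ℕ) :
    ‖poch (a : ℂ) m‖ = ∏ i ∈ Finset.range m, (a + i) := by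
  rw [poch, norm_prod]
  refine Finset.prod_congr rfl fun i _ => ?_
  rw [← Complex.ofReal_natCast, ← Complex.ofReal_add, Complex.norm_of_nonneg (by positivity)]

lemma norm_poch_le_norm_poch_add {a c : ℝ} (ha : 0 ≤ a) (hac : a ≤ c) (hc : 1 ≤ c) (m n : ℕ) :
    ‖poch (a : ℂ) m‖ ≤ ‖poch (c : ℂ) (m + n)‖ := by
  have hc0 : 0 ≤ c := by linarith
  rw [norm_poch_ofReal ha, norm_poch_ofReal hc0, Finset.prod_range_add]
  have h₁ : ∏ i ∈ Finset.range m, (a + i) ≤ ∏ i ∈ Finset.range m, (c + i) :=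
    Finset.prod_le_prod (fun i _ => by positivity) fun i _ => by linarith
  have h₂ : 1 ≤ ∏ i ∈ Finset.range n, (c + (m + i : ℕ)) :=
    Finset.one_le_prod fun i _ => le_add_of_le_of_nonneg hc (Nat.cast_nonneg _)
  have h₃ : 0 ≤ ∏ i ∈ Finset.range m, (c + i) := Finset.prod_nonneg fun i _ => by positivity
  exact h₁.trans (le_mul_of_one_le_right h₃ h₂)

lemma le_norm_poch {c : ℝ} (hc : 1 ≤ c) {k : ℕ} (hk : k ≠ 0) : c ≤ ‖poch (c : ℂ) k‖ := by
  obtain ⟨n, rfl⟩ := Nat.exists_eq_succ_of_ne_zero hk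
  have hc0 : 0 ≤ c := by linarith
  have h := norm_poch_le_norm_poch_add hc0 le_rfl hc 1 n
  rw [norm_poch_ofReal hc0 1] at h
  simpa [add_comm] using h

lemma summable_norm_pow_div_factorial_prod (x y : ℂ) :
    Summable fun p : ℕ × ℕ => ‖x‖ ^ p.1 / p.1.factorial * (‖y‖ ^ p.2 / p.2.factorial) :=
  (Real.summable_pow_div_factorial ‖x‖).mul_of_nonneg (Real.summable_pow_div_factorial ‖y‖)
    (fun _ => by positivity) fun _ => by positivity

lemma norm_Phi3_term (a c x y : ℂ) (m n : ℕ) :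
    ‖poch a m / (poch c (m + n) * (m.factorial : ℂ) * (n.factorial : ℂ)) * x ^ m * y ^ n‖ =
      ‖poch a m‖ / ‖poch c (m + n)‖ * (‖x‖ ^ m / m.factorial * (‖y‖ ^ n / n.factorial)) := by
  simp only [norm_mul, norm_div, norm_pow, Complex.norm_natCast]
  ring

/-- `Φ₃(a; c; x, y) → 1` as `c → ∞` along the reals, for `a ≥ 0`. -/
theorem tendsto_Phi3_atTop {a : ℝ} (ha : 0 ≤ a) (x y : ℂ) :
    Tendsto (fun c : ℝ => Phi3 a c x y) atTop (nhds 1) := by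
  have hsum : ∑' p : ℕ × ℕ, (if p = 0 then (1 : ℂ) else 0) = 1 := tsum_ite_eq 0 _
  rw [← hsum]
  refine tendsto_tsum_of_dominated_convergence (summable_norm_pow_div_factorial_prod x y) ?_ ?_
  · rintro ⟨m, n⟩
    split_ifs with h
    · obtain ⟨rfl, rfl⟩ := Prod.mk.inj h
      simp [poch]
    · have hk : m + n ≠ 0 := fun hmn => h (by ext <;> simp <;> omega)
      set B := ‖x‖ ^ m / m.factorial * (‖y‖ ^ n / n.factorial)
      have hB : 0 ≤ B := by positivity
      refine squeeze_zero_norm' (a := fun c : ℝ => ‖poch a m‖ / c * B) ?_ ?_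
      · filter_upwards [eventually_ge_atTop 1] with c hc
        rw [norm_Phi3_term]
        have := le_norm_poch hc hk
        gcongr
      · simpa using (tendsto_const_nhds.div_atTop tendsto_id).mul_const B
  · filter_upwards [eventually_ge_atTop 1, eventually_ge_atTop a] with c hc hac
    rintro ⟨m, n⟩
    rw [norm_Phi3_term]
    exact mul_le_of_le_one_left (by positivity)
      (div_le_one_of_le₀ (norm_poch_le_norm_poch_add ha hac hc m n) (norm_nonneg _))

/-- `Φ₃(1/2; 1/2 + 2r; x, y) → 1` as `r → ∞` over the nonnegative integers. -/
theorem Phi3_tendsto_one (x y : ℂ) :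
    Filter.Tendsto (fun r : ℕ => Phi3 (1/2) (1/2 + 2*(r:ℂ)) x y)
      Filter.atTop (nhds 1) := by
  have hc : Tendsto (fun r : ℕ => (1 / 2 + 2 * r : ℝ)) atTop atTop :=
    tendsto_atTop_add_const_left _ _
      (tendsto_natCast_atTop_atTop.const_mul_atTop (by norm_num))
  have h := (tendsto_Phi3_atTop (a := 1 / 2) (by norm_num) x y).comp hc
  refine h.congr fun r => ?_
  simp

end
end

section
/- Let $\sigma>0$, $\beta>0$, and $x\in\mathbb{R}$, and set $w=\frac{x+i\beta}{\sqrt{2}\,\sigma}$. Then the Voigt profile satisfies $V(x;\sigma,\beta)=\frac{\mathrm{Re}\big(\xi(w)\big)}{\sigma\sqrt{2\pi}}$, where $\xi(y)=e^{-y^2}\big(1-\mathrm{erf}(-iy)\big)$ is the Faddeeva function. -/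
open Complex MeasureTheory Filter

noncomputable section

theorem cerf_zero : cerf 0 = 0 := by
  simp [cerf]

/-- The complex error function is a primitive of `2 / √π * exp (-w ^ 2)`. -/
theorem hasDerivAt_cerf (w : ℂ) :
    HasDerivAt cerf (2 / (Real.sqrt Real.pi : ℂ) * cexp (-w ^ 2)) w := by
  have hd : Differentiable ℂ fun z : ℂ => cexp (-z ^ 2) := by fun_prop
  obtain ⟨F, hF⟩ := hd.isExactOn_univ
  have hcerf : cerf = fun z => 2 / (Real.sqrt Real.pi : ℂ) * (F z - F 0) := by
    funext z
    have h := intervalIntegral.integral_unitInterval_deriv_eq_sub (z₀ := (0 : ℂ)) (z₁ := z)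
      (f := F) (f' := fun z : ℂ => cexp (-z ^ 2)) (by fun_prop) fun t _ => hF _ (Set.mem_univ _)
    rw [cerf, intervalIntegral.integral_const_mul]
    simpa using congrArg (2 / (Real.sqrt Real.pi : ℂ) * ·) h
  rw [hcerf]
  exact ((hF w (Set.mem_univ _)).sub_const _).const_mul _

theorem hasDerivAt_cerf_ofReal_add (a : ℂ) (u : ℝ) :
    HasDerivAt (fun u : ℝ => cerf (u + a))
      (2 / (Real.sqrt Real.pi : ℂ) * cexp (-((u : ℂ) + a) ^ 2)) u := by
  exact ((hasDerivAt_cerf _).comp_add_const (u : ℂ) a).comp_ofReal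

theorem integrable_cexp_neg_sq_add (a : ℂ) :
    Integrable fun u : ℝ => cexp (-((u : ℂ) + a) ^ 2) := by
  refine (integrable_cexp_quadratic (b := 1) (by simp) (-2 * a) (-a ^ 2)).congr
    (Eventually.of_forall fun u => ?_)
  simp only
  ring_nf

theorem tendsto_cerf_ofReal : Tendsto (fun R : ℝ => cerf R) atTop (nhds 1) := by
  have hintegrable : Integrable fun u : ℝ => 2 / (Real.sqrt Real.pi : ℂ) * cexp (-(u : ℂ) ^ 2) := by
    simpa using (integrable_cexp_neg_sq_add 0).const_mul (2 / (Real.sqrt Real.pi : ℂ))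
  have hlim := intervalIntegral_tendsto_integral_Ioi 0 hintegrable.integrableOn tendsto_id
  have hval : ∫ u in Set.Ioi (0 : ℝ), 2 / (Real.sqrt Real.pi : ℂ) * cexp (-(u : ℂ) ^ 2) = 1 := by
    have h : ∫ u in Set.Ioi (0 : ℝ), cexp (-(u : ℂ) ^ 2) = (Real.sqrt Real.pi : ℂ) / 2 := by
      have h := congrArg ((↑) : ℝ → ℂ) (integral_gaussian_Ioi 1)
      rw [← integral_complex_ofReal] at h
      simpa using h
    have hpi : (Real.sqrt Real.pi : ℂ) ≠ 0 := by
      exact_mod_cast (Real.sqrt_pos.2 Real.pi_pos).ne'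
    rw [integral_const_mul, h]
    field_simp
  rw [hval] at hlim
  refine hlim.congr fun R => ?_
  rw [intervalIntegral.integral_eq_sub_of_hasDerivAt (f := fun u : ℝ => cerf u)
    (fun u _ => by simpa using hasDerivAt_cerf_ofReal_add 0 u) hintegrable.intervalIntegrable]
  simp [cerf_zero]

theorem norm_cexp_neg_sq_le {a z : ℂ} {R : ℝ} (hR : ‖a‖ ≤ R) (hz : ‖z - R‖ ≤ ‖a‖) :
    ‖cexp (-z ^ 2)‖ ≤ Real.exp (-(R * (R - 2 * ‖a‖))) := by
  rw [Complex.norm_exp, Real.exp_le_exp]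
  have hre : |z.re - R| ≤ ‖a‖ := by simpa using (abs_re_le_norm (z - R)).trans hz
  have him : |z.im| ≤ ‖a‖ := by simpa using (abs_im_le_norm (z - R)).trans hz
  have h1 := (abs_le.1 hre).1
  have h2 : z.im ^ 2 ≤ ‖a‖ ^ 2 := sq_le_sq' (abs_le.1 him).1 (abs_le.1 him).2
  have h3 : (R - ‖a‖) ^ 2 ≤ z.re ^ 2 := pow_le_pow_left₀ (by linarith) (by linarith) 2
  have h4 : (-z ^ 2).re = z.im ^ 2 - z.re ^ 2 := by simp [pow_two]
  rw [h4]
  nlinarith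

/-- The error function tends to `1` along every horizontal ray to the right. -/
theorem tendsto_cerf_ofReal_add (a : ℂ) :
    Tendsto (fun R : ℝ => cerf (R + a)) atTop (nhds 1) := by
  have hdiff : Tendsto (fun R : ℝ => cerf (R + a) - cerf R) atTop (nhds 0) := by
    have hbound : Tendsto (fun R : ℝ => ‖(2 / (Real.sqrt Real.pi : ℂ))‖ *
        Real.exp (-(R * (R - 2 * ‖a‖))) * ‖a‖) atTop (nhds 0) := by
      have h : Tendsto (fun R : ℝ => R * (R - 2 * ‖a‖)) atTop atTop :=
        tendsto_id.atTop_mul_atTop₀ (tendsto_atTop_add_const_right _ _ tendsto_id)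
      simpa using ((Real.tendsto_exp_neg_atTop_nhds_zero.comp h).const_mul
        ‖(2 / (Real.sqrt Real.pi : ℂ))‖).mul_const ‖a‖
    refine squeeze_zero_norm' ?_ hbound
    filter_upwards [eventually_ge_atTop ‖a‖] with R hR
    have h := (convex_closedBall (R : ℂ) ‖a‖).norm_image_sub_le_of_norm_hasDerivWithin_le
      (x := (R : ℂ)) (y := R + a) (C := ‖(2 / (Real.sqrt Real.pi : ℂ))‖ *
        Real.exp (-(R * (R - 2 * ‖a‖))))
      (fun z _ => (hasDerivAt_cerf z).hasDerivWithinAt)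
      (fun z hz => by
        rw [norm_mul]
        gcongr
        exact norm_cexp_neg_sq_le hR (mem_closedBall_iff_norm.1 hz))
      (by simp) (by simp)
    simpa using h
  simpa using hdiff.add tendsto_cerf_ofReal

theorem integral_Ioi_cexp_neg_sq_add (a : ℂ) :
    ∫ u in Set.Ioi (0 : ℝ), cexp (-((u : ℂ) + a) ^ 2) =
      (Real.sqrt Real.pi : ℂ) / 2 * (1 - cerf a) := by
  have hpi : (Real.sqrt Real.pi : ℂ) ≠ 0 := by
    exact_mod_cast (Real.sqrt_pos.2 Real.pi_pos).ne'
  have h := integral_Ioi_of_hasDerivAt_of_tendsto' (a := 0)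
    (fun u _ => hasDerivAt_cerf_ofReal_add a u)
    ((integrable_cexp_neg_sq_add a).const_mul _).integrableOn (tendsto_cerf_ofReal_add a)
  rw [integral_const_mul, ofReal_zero, zero_add] at h
  rw [← h]
  field_simp

/-- The Laplace transform of a Gaussian in terms of the error function. -/
theorem integral_Ioi_cexp_neg_sq_mul_sub {c : ℝ} (hc : 0 < c) (a : ℂ) :
    ∫ s in Set.Ioi (0 : ℝ), cexp (-((c : ℂ) * s) ^ 2 - 2 * a * (c * s)) =
      (Real.sqrt Real.pi : ℂ) / (2 * c) * (cexp (a ^ 2) * (1 - cerf a)) := by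
  have h := integral_comp_mul_left_Ioi (fun u : ℝ => cexp (-((u : ℂ) + a) ^ 2)) 0 hc
  rw [mul_zero, integral_Ioi_cexp_neg_sq_add] at h
  have hs (s : ℝ) : cexp (-((c : ℂ) * s) ^ 2 - 2 * a * (c * s)) =
      cexp (a ^ 2) * cexp (-(((c * s : ℝ) : ℂ) + a) ^ 2) := by
    rw [← Complex.exp_add]
    push_cast
    ring_nf
  simp_rw [hs]
  rw [integral_const_mul, h, real_smul]
  push_cast
  field_simp

theorem gauss_eq_gaussianPDFReal {σ : ℝ} (hσ : 0 < σ) (t : ℝ) :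
    gauss σ t = ProbabilityTheory.gaussianPDFReal 0 (σ ^ 2).toNNReal t := by
  rw [gauss, ProbabilityTheory.gaussianPDFReal, Real.coe_toNNReal _ (sq_nonneg σ),
    Real.sqrt_mul (x := 2 * Real.pi) (by positivity), Real.sqrt_sq hσ.le, sub_zero, div_eq_inv_mul,
    mul_comm σ]

theorem integrable_gauss {σ : ℝ} (hσ : 0 < σ) : Integrable (gauss σ) := by
  rw [funext (gauss_eq_gaussianPDFReal hσ)]
  exact ProbabilityTheory.integrable_gaussianPDFReal _ _

/-- The characteristic function of the centred Gaussian density. -/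
theorem integral_gauss_mul_cexp {σ : ℝ} (hσ : 0 < σ) (s : ℝ) :
    ∫ t : ℝ, (gauss σ t : ℂ) * cexp (s * t * I) = cexp (-((σ : ℂ) ^ 2 * s ^ 2 / 2)) := by
  have hv : (σ ^ 2).toNNReal ≠ 0 := by simp [hσ.ne']
  have h := ProbabilityTheory.charFun_gaussianReal (μ := 0) (v := (σ ^ 2).toNNReal) s
  rw [charFun_apply_real, ProbabilityTheory.integral_gaussianReal_eq_integral_smul hv] at h
  simpa [gauss_eq_gaussianPDFReal hσ, Real.coe_toNNReal _ (sq_nonneg σ)] using h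

/-- The Lorentzian is the real part of a Laplace transform. -/
theorem lorentz_eq_re_integral {β : ℝ} (hβ : 0 < β) (y : ℝ) :
    lorentz β y =
      (∫ s in Set.Ioi (0 : ℝ), cexp ((-β + y * I : ℂ) * s)).re / Real.pi := by
  rw [integral_exp_mul_complex_Ioi (by simpa using hβ)]
  have h : (y ^ 2 + β ^ 2) ≠ 0 := by positivity
  simp [lorentz, Complex.div_re, Complex.normSq_apply]
  field_simp
  ring

theorem integrable_gauss_mul_cexp_prod {σ β : ℝ} (hσ : 0 < σ) (hβ : 0 < β) (x : ℝ) :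
    Integrable (fun p : ℝ × ℝ => (gauss σ p.1 : ℂ) * cexp ((-β + (x - p.1 : ℝ) * I : ℂ) * p.2))
      (volume.prod (volume.restrict (Set.Ioi 0))) := by
  have h := (integrable_gauss hσ).ofReal (𝕜 := ℂ) |>.mul_prod
    (integrableOn_exp_mul_complex_Ioi (a := -β) (by simpa using hβ) 0)
  refine h.mono (Continuous.aestronglyMeasurable (by unfold gauss; fun_prop)) ?_
  refine Eventually.of_forall fun p => ?_
  simp [Complex.norm_exp]

/-- The Voigt profile as the real part of a one-sided Fourier integral. -/
theorem voigt_eq_re_integral {σ β : ℝ} (hσ : 0 < σ) (hβ : 0 < β) (x : ℝ) :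
    voigt σ β x = (∫ s in Set.Ioi (0 : ℝ),
      cexp ((-β + x * I : ℂ) * s - (σ : ℂ) ^ 2 * s ^ 2 / 2)).re / Real.pi := by
  have hintegrable := integrable_gauss_mul_cexp_prod hσ hβ x
  have hleft : Integrable fun t : ℝ => ∫ s in Set.Ioi (0 : ℝ),
      (gauss σ t : ℂ) * cexp ((-β + (x - t : ℝ) * I : ℂ) * s) := hintegrable.integral_prod_left
  have hvoigt : voigt σ β x = (∫ t : ℝ, ∫ s in Set.Ioi (0 : ℝ),
      (gauss σ t : ℂ) * cexp ((-β + (x - t : ℝ) * I : ℂ) * s)).re / Real.pi := by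
    rw [← RCLike.re_to_complex, ← integral_re hleft, ← integral_div, voigt]
    refine integral_congr_ae (Eventually.of_forall fun t => ?_)
    simp only
    rw [lorentz_eq_re_integral hβ, integral_const_mul, RCLike.re_to_complex, re_ofReal_mul,
      mul_div_assoc]
  rw [hvoigt, integral_integral_swap hintegrable]
  congr 3
  funext s
  have hs (t : ℝ) : (gauss σ t : ℂ) * cexp ((-β + (x - t : ℝ) * I : ℂ) * s) =
      cexp ((-β + x * I : ℂ) * s) * ((gauss σ t : ℂ) * cexp ((-s : ℝ) * t * I)) := by
    rw [mul_left_comm, ← Complex.exp_add]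
    push_cast
    ring_nf
  simp_rw [hs]
  rw [integral_const_mul, integral_gauss_mul_cexp hσ, ← Complex.exp_add]
  push_cast
  ring_nf

/-- the Voigt profile in terms of the Faddeeva function. -/
theorem voigt_eq_faddeeva (σ β x : ℝ) (hσ : 0 < σ) (hβ : 0 < β) :
    voigt σ β x
      = (faddeeva (((x:ℂ) + Complex.I * (β:ℂ)) / ((Real.sqrt 2 : ℂ) * (σ:ℂ)))).re
          / (σ * Real.sqrt (2 * Real.pi)) := by
  set w : ℂ := ((x:ℂ) + Complex.I * (β:ℂ)) / ((Real.sqrt 2 : ℂ) * (σ:ℂ)) with hw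
  have h2 : (Real.sqrt 2 : ℂ) ≠ 0 := by exact_mod_cast (Real.sqrt_pos.2 two_pos).ne'
  have h2sq : (Real.sqrt 2 : ℂ) ^ 2 = 2 := by exact_mod_cast Real.sq_sqrt zero_le_two
  have hσ' : (σ : ℂ) ≠ 0 := by exact_mod_cast hσ.ne'
  have hexp (s : ℝ) : (-β + x * I : ℂ) * s - (σ : ℂ) ^ 2 * s ^ 2 / 2 =
      -(((σ / Real.sqrt 2 : ℝ) : ℂ) * s) ^ 2 -
        2 * (-I * w) * (((σ / Real.sqrt 2 : ℝ) : ℂ) * s) := by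
    rw [hw]
    push_cast
    field_simp
    rw [h2sq]
    ring_nf
    simp only [I_sq]
    ring
  have hfad : faddeeva w = cexp ((-I * w) ^ 2) * (1 - cerf (-I * w)) := by
    rw [faddeeva, mul_pow, neg_sq, I_sq, neg_one_mul]
  have hconst : (Real.sqrt Real.pi : ℂ) / (2 * ((σ / Real.sqrt 2 : ℝ) : ℂ)) =
      ((Real.sqrt Real.pi / (2 * (σ / Real.sqrt 2)) : ℝ) : ℂ) := by push_cast; rfl
  rw [voigt_eq_re_integral hσ hβ]
  simp_rw [hexp]
  rw [integral_Ioi_cexp_neg_sq_mul_sub (by positivity), ← hfad, hconst, re_ofReal_mul,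
    Real.sqrt_mul zero_le_two]
  have hpi := Real.sq_sqrt Real.pi_pos.le
  have htwo := Real.sq_sqrt (zero_le_two (α := ℝ))
  have hpi0 := Real.pi_pos
  field_simp
  rw [hpi, htwo]
  ring

end
end
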